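/- arXiv:1704.08934 — 2 statements merged into one kernel-verified Lean document; each statement's English description precedes it below -/
import Mathlib

section
/- For every n ≥ 9, every propagation complete encoding of the function AMO_n has at least 2n + √n − 2 clauses, and every propagation complete encoding of the function EXO_n has at least 2n + √n − 2 clauses. -/
/-- A literal is a variable together with a polarity (`true` = positive). -/
abbrev Lit (V : Type) := V × Bool

/-- The negation of a literal. -/
def negLit {V : Type} (l : Lit V) : Lit V := (l.1, !l.2)

/-- A clause is a finite set of literals. -/
abbrev Clause (V : Type) := Finset (Lit V)

/-- A CNF formula is a finite set of clauses. -/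
abbrev CNF (V : Type) := Finset (Clause V)

/-- A clause proper contains no complementary pair of literals. -/
def IsClause {V : Type} [DecidableEq V] (C : Clause V) : Prop := ∀ l ∈ C, negLit l ∉ C

instance {V : Type} [DecidableEq V] (C : Clause V) : Decidable (IsClause C) := by
  unfold IsClause; infer_instance

/-- A CNF formula proper consists of proper clauses. -/
def IsCNF {V : Type} [DecidableEq V] (φ : CNF V) : Prop := ∀ C ∈ φ, IsClause C

/-- Satisfaction of a literal by an assignment. -/
def LitSat {V : Type} (α : V → Bool) (l : Lit V) : Prop := α l.1 = l.2

/-- Satisfaction of a clause by an assignment. -/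
def ClauseSat {V : Type} (α : V → Bool) (C : Clause V) : Prop := ∃ l ∈ C, LitSat α l

/-- Satisfaction of a CNF formula by an assignment. -/
def CnfSat {V : Type} (α : V → Bool) (φ : CNF V) : Prop := ∀ C ∈ φ, ClauseSat α C

/-- `UnitDerives φ C` : the clause `C` can be derived from `φ` by a series of unit
resolutions (each step resolves a derived unit clause with another derived clause). -/
inductive UnitDerives {V : Type} [DecidableEq V] (φ : CNF V) : Clause V → Prop
  | base {C : Clause V} (h : C ∈ φ) : UnitDerives φ C
  | step {l : Lit V} {C : Clause V} (h1 : UnitDerives φ {l})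
      (h2 : UnitDerives φ C) (h3 : negLit l ∈ C) :
      UnitDerives φ (C.erase (negLit l))

/-- The formula `φ ∧ l` (adding a unit clause). -/
def addUnit {V : Type} [DecidableEq V] (φ : CNF V) (l : Lit V) : CNF V :=
  insert {l} φ

/-- The formula `φ ∧ g₁ ∧ … ∧ g_p` (adding finitely many unit clauses). -/
def addUnits {V : Type} [DecidableEq V] (φ : CNF V) (L : Finset (Lit V)) : CNF V :=
  φ ∪ L.image (fun l => ({l} : Clause V))

/-- Variables: `n` input variables and `ℓ` auxiliary variables. -/
abbrev Var (n ℓ : ℕ) : Type := Sum (Fin n) (Fin ℓ)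

/-- The literal on the `i`-th input variable with polarity `b`. -/
def inLit {n ℓ : ℕ} (i : Fin n) (b : Bool) : Lit (Var n ℓ) := (Sum.inl i, b)

/-- A p-encoding: (P1) `φ ∧ x_i` is satisfiable for each input variable `x_i`, and
(P2) `φ ∧ x_i ⊢₁ ¬x_j` for all `i ≠ j`. -/
def IsPEncoding {n ℓ : ℕ} (φ : CNF (Var n ℓ)) : Prop :=
  IsCNF φ ∧
  (∀ i : Fin n, ∃ α : Var n ℓ → Bool, CnfSat α φ ∧ α (Sum.inl i) = true) ∧
  (∀ i j : Fin n, i ≠ j →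
    UnitDerives (addUnit φ (inLit i true)) {inLit j false})

/-- A p-encoding relative to a set `I` of input indices. -/
def IsPEncodingOn {n ℓ : ℕ} (φ : CNF (Var n ℓ)) (I : Finset (Fin n)) : Prop :=
  IsCNF φ ∧
  (∀ i ∈ I, ∃ α : Var n ℓ → Bool, CnfSat α φ ∧ α (Sum.inl i) = true) ∧
  (∀ i ∈ I, ∀ j ∈ I, i ≠ j →
    UnitDerives (addUnit φ (inLit i true)) {inLit j false})

/-- 2-CNF: every clause has at most two literals. -/
def Is2CNF {V : Type} (φ : CNF V) : Prop := ∀ C ∈ φ, C.card ≤ 2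

/-- The set of possible sizes of p-encodings with `n` input variables. -/
def pencSizes (n : ℕ) : Set ℕ :=
  {k | ∃ ℓ : ℕ, ∃ φ : CNF (Var n ℓ), IsPEncoding φ ∧ φ.card = k}

/-- `S n` : the minimum size of a p-encoding with `n` input variables. -/
noncomputable def S (n : ℕ) : ℕ := sInf (pencSizes n)

/-- The set of possible sizes of 2-CNF p-encodings with `n` input variables. -/
def penc2Sizes (n : ℕ) : Set ℕ :=
  {k | ∃ ℓ : ℕ, ∃ φ : CNF (Var n ℓ), IsPEncoding φ ∧ Is2CNF φ ∧ φ.card = k}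

/-- `S₂ n` : the minimum size of a 2-CNF p-encoding with `n` input variables. -/
noncomputable def S2 (n : ℕ) : ℕ := sInf (penc2Sizes n)

/-- `φ(x,y)` is an encoding of the boolean function `f(x)`. -/
def Encodes {n ℓ : ℕ} (φ : CNF (Var n ℓ)) (f : (Fin n → Bool) → Prop) : Prop :=
  IsCNF φ ∧
  ∀ α : Fin n → Bool, f α ↔ ∃ β : Fin ℓ → Bool, CnfSat (Sum.elim α β) φ

/-- Injection of literals on input variables into literals of the encoding. -/
def inLits {n ℓ : ℕ} (G : Finset (Lit (Fin n))) : Finset (Lit (Var n ℓ)) :=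
  G.image (fun g => ((Sum.inl g.1 : Var n ℓ), g.2))

/-- Propagation complete encoding of `f`: an encoding such that whenever
`f ∧ g₁ ∧ … ∧ g_p ⊨ h` for literals on input variables (`p ≥ 1`), unit propagation
from `φ ∧ g₁ ∧ … ∧ g_p` derives `h` or derives the empty clause. -/
def IsPCEncoding {n ℓ : ℕ} (φ : CNF (Var n ℓ)) (f : (Fin n → Bool) → Prop) : Prop :=
  Encodes φ f ∧
  ∀ G : Finset (Lit (Fin n)), G.Nonempty → ∀ h : Lit (Fin n),
    (∀ α : Fin n → Bool, f α → (∀ g ∈ G, α g.1 = g.2) → α h.1 = h.2) →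
    (UnitDerives (addUnits φ (inLits G)) {((Sum.inl h.1 : Var n ℓ), h.2)} ∨
     UnitDerives (addUnits φ (inLits G)) (∅ : Clause (Var n ℓ)))

/-- The "at most one" function. -/
def AMO (n : ℕ) (α : Fin n → Bool) : Prop :=
  (Finset.univ.filter fun i => α i = true).card ≤ 1

/-- The "exactly one" function. -/
def EXO (n : ℕ) (α : Fin n → Bool) : Prop :=
  (Finset.univ.filter fun i => α i = true).card = 1

/-- `Qset φ i` : the set of clauses of `φ` containing the literal `¬x_i`. -/
def Qset {n ℓ : ℕ} (φ : CNF (Var n ℓ)) (i : Fin n) : CNF (Var n ℓ) :=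
  φ.filter (fun C => inLit i false ∈ C)

/-- Regular form: for each `i`, `|Q_i| = 2`, clauses of `Q_i` contain no input variables
other than `x_i`, and all clauses of `Q_i` are binary. -/
def RegularForm {n ℓ : ℕ} (φ : CNF (Var n ℓ)) : Prop :=
  ∀ i : Fin n,
    (Qset φ i).card = 2 ∧
    (∀ C ∈ Qset φ i, ∀ j : Fin n, ∀ b : Bool, ((Sum.inl j : Var n ℓ), b) ∈ C → j = i) ∧
    (∀ C ∈ Qset φ i, C.card = 2)

/-- `C` is an implicate of `φ`. -/
def Implicate {V : Type} (φ : CNF V) (C : Clause V) : Prop :=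
  ∀ α : V → Bool, CnfSat α φ → ClauseSat α C

/-- `C` is a prime implicate of `φ`. -/
def PrimeImplicate {V : Type} (φ : CNF V) (C : Clause V) : Prop :=
  Implicate φ C ∧ ∀ C' : Clause V, C' ⊂ C → ¬ Implicate φ C'

/-- `φ` is prime: every clause of `φ` is a prime implicate of `φ`. -/
def IsPrime {V : Type} (φ : CNF V) : Prop := ∀ C ∈ φ, PrimeImplicate φ C

/-- The set of clauses of `φ` in which the auxiliary variable `y` occurs
(as a positive or negative literal). -/
def occursIn {n ℓ : ℕ} (φ : CNF (Var n ℓ)) (y : Fin ℓ) : CNF (Var n ℓ) :=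
  φ.filter (fun C => ((Sum.inr y : Var n ℓ), true) ∈ C ∨ ((Sum.inr y : Var n ℓ), false) ∈ C)

/-- The substitution `g₁ ← g₂` on a literal: `g₁ ↦ g₂`, `¬g₁ ↦ ¬g₂`,
all other literals unchanged. -/
def substLit {V : Type} [DecidableEq V] (g₁ g₂ : Lit V) (l : Lit V) : Lit V :=
  if l.1 = g₁.1 then (if l.2 = g₁.2 then g₂ else negLit g₂) else l

/-- The substitution `g₁ ← g₂` applied to a clause. -/
def substClause {V : Type} [DecidableEq V] (g₁ g₂ : Lit V) (C : Clause V) : Clause V :=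
  C.image (substLit g₁ g₂)

/-- The formula `φ[g₁ ← g₂]`: apply the substitution to every clause and remove the
clauses that became tautological (i.e. contain a complementary pair of literals). -/
def substCNF {V : Type} [DecidableEq V] (g₁ g₂ : Lit V) (φ : CNF V) : CNF V :=
  (φ.image (substClause g₁ g₂)).filter (fun C => IsClause C)

/-- `restrict φ ρ` : the formula `φ(ρ)` obtained from `φ` by the partial assignment
given by the set of literals `ρ` (clauses satisfied by `ρ` are removed, and falsified
literals are removed from the remaining clauses). -/
def restrict {V : Type} [DecidableEq V] (φ : CNF V) (ρ : Finset (Lit V)) : CNF V :=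
  (φ.filter (fun C => ∀ l ∈ ρ, l ∉ C)).image (fun C => C.filter (fun l => negLit l ∉ ρ))

section UnitPropagation

variable {V : Type}

lemma negLit_negLit (l : Lit V) : negLit (negLit l) = l := by
  simp [negLit]

lemma negLit_injective : Function.Injective (negLit : Lit V → Lit V) :=
  Function.Involutive.injective negLit_negLit

lemma eq_or_eq_negLit_of_fst_eq {l m : Lit V} (h : l.1 = m.1) : l = m ∨ l = negLit m := by
  by_cases h2 : l.2 = m.2
  · exact .inl (Prod.ext h h2)
  · exact .inr (Prod.ext h (Bool.eq_not_of_ne h2))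

lemma litSat_negLit {α : V → Bool} {l : Lit V} : LitSat α (negLit l) ↔ ¬ LitSat α l := by
  unfold LitSat negLit
  cases α l.1 <;> cases l.2 <;> simp

/-- `UP φ u l`: unit propagation on `φ ∧ u` derives the literal `l`. -/
inductive UP (φ : CNF V) (u : Lit V) : Lit V → Prop
  | start : UP φ u u
  | unit {C : Clause V} {l : Lit V} (hC : C ∈ φ) (hl : l ∈ C)
      (h : ∀ m ∈ C, m ≠ l → UP φ u (negLit m)) : UP φ u l

lemma UP.litSat {φ : CNF V} {u l : Lit V} (h : UP φ u l) {α : V → Bool}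
    (hφ : CnfSat α φ) (hu : LitSat α u) : LitSat α l := by
  induction h with
  | start => exact hu
  | @unit C l hC hl _ ih =>
    obtain ⟨m, hm, hs⟩ := hφ C hC
    by_cases hml : m = l
    · exact hml ▸ hs
    · exact absurd hs (litSat_negLit.1 (ih m hm hml))

/-- Unit propagation is not weakened by replacing clauses with subclauses, as long as the
result stays satisfiable. -/
lemma UP.mono {φ ψ : CNF V} {u l : Lit V} (h : UP φ u l)
    (hsub : ∀ C ∈ φ, ∃ D ∈ ψ, D ⊆ C) {α : V → Bool} (hψ : CnfSat α ψ) (hu : LitSat α u) :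
    UP ψ u l := by
  induction h with
  | start => exact .start
  | @unit C l hC hl _ ih =>
    obtain ⟨D, hD, hDC⟩ := hsub C hC
    by_cases hlD : l ∈ D
    · exact .unit hD hlD fun m hm hml => ih m (hDC hm) hml
    · obtain ⟨m, hm, hs⟩ := hψ D hD
      have := (ih m (hDC hm) (fun e => hlD (e ▸ hm))).litSat hψ hu
      exact absurd hs (litSat_negLit.1 this)

/-- A p-encoding whose input literals form the set `X`: each input literal is true in some
model, and each input literal propagates the negation of every other one. -/
def IsLitPEncoding (φ : CNF V) (X : Finset (Lit V)) : Prop :=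
  (∀ x ∈ X, ∃ α : V → Bool, CnfSat α φ ∧ LitSat α x) ∧
  ∀ x ∈ X, ∀ v ∈ X, x ≠ v → UP φ x (negLit v)

lemma IsLitPEncoding.not_litSat {φ : CNF V} {X : Finset (Lit V)} (h : IsLitPEncoding φ X)
    {x v : Lit V} (hx : x ∈ X) (hv : v ∈ X) (hxv : x ≠ v) {α : V → Bool} (hα : CnfSat α φ)
    (hs : LitSat α x) : ¬ LitSat α v :=
  litSat_negLit.1 ((h.2 x hx v hv hxv).litSat hα hs)

lemma IsLitPEncoding.not_up_both {φ : CNF V} {X : Finset (Lit V)} (h : IsLitPEncoding φ X)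
    {x l : Lit V} (hx : x ∈ X) (h1 : UP φ x l) (h2 : UP φ x (negLit l)) : False := by
  obtain ⟨α, hα, hs⟩ := h.1 x hx
  exact litSat_negLit.1 (h2.litSat hα hs) (h1.litSat hα hs)

/-- A p-encoding that is minimal, first in the number of clauses and then in their total
length, among those with the same number of inputs. -/
def IsMinimal (φ : CNF V) (X : Finset (Lit V)) : Prop :=
  IsLitPEncoding φ X ∧ ∀ (ψ : CNF V) (Y : Finset (Lit V)), IsLitPEncoding ψ Y →
    Y.card = X.card → φ.card ≤ ψ.card ∧
      (ψ.card = φ.card → ∑ C ∈ φ, C.card ≤ ∑ C ∈ ψ, C.card)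

lemma IsLitPEncoding.exists_isMinimal {φ : CNF V} {X : Finset (Lit V)}
    (h : IsLitPEncoding φ X) : ∃ (ψ : CNF V) (Y : Finset (Lit V)), IsMinimal ψ Y ∧
      Y.card = X.card ∧ ψ.card ≤ φ.card := by
  let f : CNF V × Finset (Lit V) → ℕ ×ₗ ℕ := fun p => toLex (p.1.card, ∑ C ∈ p.1, C.card)
  obtain ⟨⟨ψ, Y⟩, ⟨hψ, hY⟩, hmin⟩ := (InvImage.wf f wellFounded_lt).has_min
    {p | IsLitPEncoding p.1 p.2 ∧ p.2.card = X.card} ⟨(φ, X), h, rfl⟩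
  have key : ∀ (χ : CNF V) (Z : Finset (Lit V)), IsLitPEncoding χ Z → Z.card = X.card →
      ψ.card ≤ χ.card ∧ (χ.card = ψ.card → ∑ C ∈ ψ, C.card ≤ ∑ C ∈ χ, C.card) := by
    intro χ Z hχ hZ
    have := hmin (χ, Z) ⟨hχ, hZ⟩
    simp only [InvImage, f, Prod.Lex.toLex_lt_toLex, not_or, not_and, not_lt] at this
    exact ⟨this.1, this.2⟩
  exact ⟨ψ, Y, ⟨hψ, fun χ Z hχ hZ => key χ Z hχ (hZ.trans hY)⟩, hY, (key φ X h rfl).1⟩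

lemma IsMinimal.card_le {φ ψ : CNF V} {X Y : Finset (Lit V)} (h : IsMinimal φ X)
    (hψ : IsLitPEncoding ψ Y) (hY : Y.card = X.card) : φ.card ≤ ψ.card :=
  (h.2 ψ Y hψ hY).1

variable [DecidableEq V]

lemma IsLitPEncoding.negLit_ne {φ : CNF V} {X : Finset (Lit V)} (h : IsLitPEncoding φ X)
    (h3 : 3 ≤ X.card) {x v : Lit V} (hx : x ∈ X) (hv : v ∈ X) : negLit v ≠ x := by
  intro e
  obtain ⟨w, hw, hwn⟩ : ∃ w ∈ X, w ∉ ({x, v} : Finset (Lit V)) :=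
    Finset.exists_mem_notMem_of_card_lt_card (lt_of_le_of_lt Finset.card_le_two h3)
  simp only [Finset.mem_insert, Finset.mem_singleton, not_or] at hwn
  obtain ⟨α, hα, hs⟩ := h.1 w hw
  have h1 := h.not_litSat hw hx hwn.1 hα hs
  have h2 := h.not_litSat hw hv hwn.2 hα hs
  exact h1 (e ▸ litSat_negLit.2 h2)

/-- The clauses of `φ` containing the negation of `x`. -/
def negOcc (φ : CNF V) (x : Lit V) : CNF V := φ.filter fun C => negLit x ∈ C

lemma mem_negOcc {φ : CNF V} {x : Lit V} {C : Clause V} :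
    C ∈ negOcc φ x ↔ C ∈ φ ∧ negLit x ∈ C := by
  simp [negOcc]

/-- The formula obtained from `φ` by making the literal `l` true. -/
def assign (φ : CNF V) (l : Lit V) : CNF V :=
  (φ.filter fun C => l ∉ C).image fun C => C.erase (negLit l)

lemma cnfSat_assign {φ : CNF V} {l : Lit V} {α : V → Bool} (hφ : CnfSat α φ)
    (hl : LitSat α l) : CnfSat α (assign φ l) := by
  intro D hD
  simp only [assign, Finset.mem_image, Finset.mem_filter] at hD
  obtain ⟨C, ⟨hC, -⟩, rfl⟩ := hD
  obtain ⟨m, hm, hs⟩ := hφ C hC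
  refine ⟨m, Finset.mem_erase.2 ⟨?_, hm⟩, hs⟩
  rintro rfl
  exact litSat_negLit.1 hs hl

lemma UP.assign {φ : CNF V} {u l m : Lit V} (h : UP φ u m) {α : V → Bool}
    (hφ : CnfSat α φ) (hu : LitSat α u) (hl : LitSat α l) : m = l ∨ UP (assign φ l) u m := by
  induction h with
  | start => exact .inr .start
  | @unit C m hC hm h ih =>
    have hsat : LitSat α m := (UP.unit hC hm h).litSat hφ hu
    by_cases hml : m = l
    · exact .inl hml
    right
    have hlC : l ∉ C := fun hlC =>
      litSat_negLit.1 ((h l hlC (Ne.symm hml)).litSat hφ hu) hl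
    refine .unit (C := C.erase (negLit l))
      (Finset.mem_image.2 ⟨C, Finset.mem_filter.2 ⟨hC, hlC⟩, rfl⟩) ?_ ?_
    · refine Finset.mem_erase.2 ⟨?_, hm⟩
      rintro rfl
      exact litSat_negLit.1 hsat hl
    · intro k hk hkm
      obtain ⟨hk1, hk2⟩ := Finset.mem_erase.1 hk
      refine (ih k hk2 hkm).resolve_left ?_
      rintro rfl
      exact hk1 (negLit_negLit k).symm

lemma card_assign_le (φ : CNF V) (l : Lit V) :
    (assign φ l).card + (φ.filter fun C => l ∈ C).card ≤ φ.card := by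
  have h1 : (assign φ l).card ≤ (φ.filter fun C => l ∉ C).card := Finset.card_image_le
  have h2 := Finset.card_filter_add_card_filter_not (s := φ) (fun C => l ∈ C)
  omega

lemma IsLitPEncoding.assign_negLit {φ : CNF V} {X : Finset (Lit V)} (h : IsLitPEncoding φ X)
    {x : Lit V} (hx : x ∈ X) : IsLitPEncoding (assign φ (negLit x)) (X.erase x) := by
  have key : ∀ v ∈ X.erase x, ∃ α : V → Bool, CnfSat α φ ∧ LitSat α v ∧
      LitSat α (negLit x) := by
    intro v hv
    obtain ⟨hvx, hv⟩ := Finset.mem_erase.1 hv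
    obtain ⟨α, hα, hs⟩ := h.1 v hv
    exact ⟨α, hα, hs, litSat_negLit.2 (h.not_litSat hv hx hvx hα hs)⟩
  refine ⟨fun v hv => ?_, fun v hv w hw hvw => ?_⟩
  · obtain ⟨α, hα, hs, hn⟩ := key v hv
    exact ⟨α, cnfSat_assign hα hn, hs⟩
  · obtain ⟨α, hα, hs, hn⟩ := key v hv
    refine ((h.2 v (Finset.mem_of_mem_erase hv) w (Finset.mem_of_mem_erase hw) hvw).assign
      hα hs hn).resolve_left fun e => ?_
    exact Finset.ne_of_mem_erase hw (negLit_injective e)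

lemma IsLitPEncoding.assign_of_unit {φ : CNF V} {X : Finset (Lit V)}
    (h : IsLitPEncoding φ X) {l : Lit V} (hl : {l} ∈ φ) : IsLitPEncoding (assign φ l) X := by
  have key : ∀ α : V → Bool, CnfSat α φ → LitSat α l := by
    intro α hα
    obtain ⟨m, hm, hs⟩ := hα _ hl
    exact Finset.mem_singleton.1 hm ▸ hs
  refine ⟨fun v hv => ?_, fun v hv w hw hvw => ?_⟩
  · obtain ⟨α, hα, hs⟩ := h.1 v hv
    exact ⟨α, cnfSat_assign hα (key α hα), hs⟩
  · obtain ⟨α, hα, hs⟩ := h.1 v hv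
    refine ((h.2 v hv w hw hvw).assign hα hs (key α hα)).resolve_left ?_
    rintro rfl
    obtain ⟨β, hβ, hsw⟩ := h.1 w hw
    exact litSat_negLit.1 (key β hβ) hsw

lemma substLit_negLit (g₁ g₂ l : Lit V) :
    substLit g₁ g₂ (negLit l) = negLit (substLit g₁ g₂ l) := by
  unfold substLit
  by_cases h : l.1 = g₁.1
  · rcases l with ⟨a, b⟩
    rcases g₁ with ⟨c, d⟩
    cases b <;> cases d <;> simp_all [negLit]
  · simp [negLit, h]

lemma litSat_substLit {α : V → Bool} {g₁ g₂ : Lit V} (h : LitSat α g₁ ↔ LitSat α g₂)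
    (l : Lit V) : LitSat α (substLit g₁ g₂ l) ↔ LitSat α l := by
  unfold substLit
  split_ifs with h1 h2
  · rw [← h, Prod.ext h1 h2]
  · have : l = negLit g₁ := (eq_or_eq_negLit_of_fst_eq h1).resolve_left fun e => h2 (by rw [e])
    rw [this, litSat_negLit, litSat_negLit, h]
  · rfl

/-- Identifying an input literal `x` with a literal `g` makes the clause `¬x ∨ g`
superfluous. -/
lemma IsLitPEncoding.subst {φ : CNF V} {X : Finset (Lit V)} (h : IsLitPEncoding φ X)
    {x g : Lit V} (hne : g.1 ≠ x.1)
    (hC : {negLit x, g} ∈ φ)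
    (heq : ∀ v ∈ X, ∀ α : V → Bool, CnfSat α φ → LitSat α v → (LitSat α x ↔ LitSat α g)) :
    ∃ (ψ : CNF V) (Y : Finset (Lit V)), IsLitPEncoding ψ Y ∧ Y.card = X.card ∧
      ψ.card < φ.card := by
  set σ := substLit x g with hσ
  have hσx : σ x = g := by simp [hσ, substLit]
  have hσg : σ g = g := by simp [hσ, substLit, hne]
  have hprop : ∀ v ∈ X, ∀ m, UP φ v m →
      UP ((φ.erase {negLit x, g}).image fun C => C.image σ) (σ v) (σ m) := by
    intro v hv m hm
    induction hm with
    | start => exact .start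
    | @unit C m hCφ hm _ ih =>
      by_cases hCx : C = {negLit x, g}
      · subst hCx
        rcases Finset.mem_insert.1 hm with e | e
        · subst e
          have hgx : g ≠ negLit x := fun e => hne (by rw [e]; rfl)
          have hσn : σ (negLit x) = σ (negLit g) := by
            simp only [hσ, substLit_negLit]
            rw [← hσ, hσx, hσg]
          exact hσn ▸ ih g (by simp) hgx
        · rw [Finset.mem_singleton] at e
          subst e
          have hgx : negLit x ≠ m := fun e => hne (by rw [← e]; rfl)
          have := ih (negLit x) (by simp) hgx
          rwa [negLit_negLit, hσx.trans hσg.symm] at this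
      · refine .unit (C := C.image σ) (Finset.mem_image.2
          ⟨C, Finset.mem_erase.2 ⟨hCx, hCφ⟩, rfl⟩) (Finset.mem_image_of_mem _ hm) ?_
        intro k hk hkm
        obtain ⟨k', hk', rfl⟩ := Finset.mem_image.1 hk
        have := ih k' hk' (fun e => hkm (by rw [e]))
        rwa [hσ, substLit_negLit] at this
  have hinj : Set.InjOn σ X := by
    intro v hv w hw e
    by_contra hvw
    obtain ⟨α, hα, hs⟩ := h.1 v hv
    have h1 := (litSat_substLit (heq v hv α hα hs) v).2 hs
    have h2 := (litSat_substLit (heq v hv α hα hs) w).1 (by rw [← hσ, ← e]; exact h1)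
    exact h.not_litSat hv hw hvw hα hs h2
  refine ⟨(φ.erase {negLit x, g}).image fun C => C.image σ, X.image σ, ⟨?_, ?_⟩,
    Finset.card_image_of_injOn hinj,
    lt_of_le_of_lt Finset.card_image_le (Finset.card_erase_lt_of_mem hC)⟩
  · intro y hy
    obtain ⟨v, hv, rfl⟩ := Finset.mem_image.1 hy
    obtain ⟨α, hα, hs⟩ := h.1 v hv
    have hiff := litSat_substLit (heq v hv α hα hs)
    refine ⟨α, ?_, (hiff v).2 hs⟩
    intro D hD
    obtain ⟨C, hCφ, rfl⟩ := Finset.mem_image.1 hD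
    obtain ⟨m, hm, hsm⟩ := hα C (Finset.mem_of_mem_erase hCφ)
    exact ⟨σ m, Finset.mem_image_of_mem _ hm, (hiff m).2 hsm⟩
  · intro y hy z hz hyz
    obtain ⟨v, hv, rfl⟩ := Finset.mem_image.1 hy
    obtain ⟨w, hw, rfl⟩ := Finset.mem_image.1 hz
    rw [hσ, ← substLit_negLit]
    exact hprop v hv _ (h.2 v hv w hw fun e => hyz (by rw [e]))

/-- In a formula without unit clauses, propagation from `x` starts with a binary clause. -/
lemma UP.exists_binary {φ : CNF V} (hunit : ∀ l, {l} ∉ φ) {x m : Lit V} (h : UP φ x m) :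
    m = x ∨ ∃ g, {negLit x, g} ∈ φ ∧ g.1 ≠ x.1 := by
  induction h with
  | start => exact .inl rfl
  | @unit C l hC hl _ ih =>
    by_cases hg : ∃ g, {negLit x, g} ∈ φ ∧ g.1 ≠ x.1
    · exact .inr hg
    have hsub : ∀ m ∈ C, m ≠ l → m = negLit x := fun m hm hml => by
      rw [← (ih m hm hml).resolve_right hg, negLit_negLit]
    have hx : negLit x ∈ C ∧ negLit x ≠ l := by
      by_contra hcon
      refine hunit l ?_
      have : C = {l} := Finset.eq_singleton_iff_unique_mem.2 ⟨hl, fun m hm => by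
        by_contra hml
        have e := hsub m hm hml
        exact hcon (e ▸ ⟨hm, hml⟩)⟩
      exact this ▸ hC
    have hCeq : C = {negLit x, l} := by
      ext m
      simp only [Finset.mem_insert, Finset.mem_singleton]
      constructor
      · intro hm
        by_cases hml : m = l
        · exact .inr hml
        · exact .inl (hsub m hm hml)
      · rintro (rfl | rfl)
        exacts [hx.1, hl]
    by_cases hlx : l = x
    · exact .inl hlx
    refine absurd ⟨l, hCeq ▸ hC, fun e => ?_⟩ hg
    rcases eq_or_eq_negLit_of_fst_eq e with e | e
    exacts [hlx e, hx.2 e.symm]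

/-- If `¬x ∨ g` is the only clause containing `¬x`, propagation from `x` passes through `g`. -/
lemma UP.of_unique_binary {φ : CNF V} {x g m : Lit V}
    (huniq : ∀ C ∈ φ, negLit x ∈ C → C = {negLit x, g}) (h : UP φ x m)
    {α : V → Bool} (hα : CnfSat α φ) (hx : LitSat α x) : m = x ∨ UP φ g m := by
  induction h with
  | start => exact .inl rfl
  | @unit C l hC hl h ih =>
    right
    have hsat : LitSat α l := (UP.unit hC hl h).litSat hα hx
    by_cases hxC : negLit x ∈ C
    · rw [huniq C hC hxC, Finset.mem_insert, Finset.mem_singleton] at hl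
      rcases hl with rfl | rfl
      · exact absurd hx (litSat_negLit.1 hsat)
      · exact .start
    · refine .unit hC hl fun m hm hml => (ih m hm hml).resolve_left fun e => ?_
      rw [← e, negLit_negLit] at hxC
      exact hxC hm

/-- If propagation from `x` uses at most one clause containing `¬x`, the encoding can be made
smaller. -/
lemma IsLitPEncoding.exists_smaller_of_unique {φ ψ : CNF V} {X : Finset (Lit V)}
    (h : IsLitPEncoding φ X) (h3 : 3 ≤ X.card) (hunit : ∀ l, {l} ∉ φ) {x : Lit V}
    (hx : x ∈ X) (hψφ : ψ ⊆ φ) (hup : ∀ m, UP φ x m → UP ψ x m)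
    (hψ : (negOcc ψ x).card ≤ 1) :
    ∃ (φ' : CNF V) (Y : Finset (Lit V)), IsLitPEncoding φ' Y ∧ Y.card = X.card ∧
      φ'.card < φ.card := by
  obtain ⟨v, hv, hvx⟩ := Finset.exists_mem_ne (s := X) (by omega) x
  obtain ⟨α, hα, hs⟩ := h.1 x hx
  have hαψ : CnfSat α ψ := fun C hC => hα C (hψφ hC)
  obtain ⟨g, hg, hgx⟩ := ((hup _ (h.2 x hx v hv hvx.symm)).exists_binary
    fun l hl => hunit l (hψφ hl)).resolve_left (h.negLit_ne h3 hx hv)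
  have huniq : ∀ C ∈ ψ, negLit x ∈ C → C = {negLit x, g} := fun C hC hxC =>
    Finset.card_le_one.1 hψ C (mem_negOcc.2 ⟨hC, hxC⟩) _ (mem_negOcc.2 ⟨hg, by simp⟩)
  refine h.subst hgx (hψφ hg) fun w hw β hβ hsw => ?_
  by_cases hwx : w = x
  · subst hwx
    refine ⟨fun _ => ?_, fun _ => hsw⟩
    obtain ⟨m, hm, hsm⟩ := hβ _ (hψφ hg)
    rw [Finset.mem_insert, Finset.mem_singleton] at hm
    rcases hm with rfl | rfl
    · exact absurd hsw (litSat_negLit.1 hsm)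
    · exact hsm
  · have hgw : UP ψ g (negLit w) :=
      ((hup _ (h.2 x hx w hw (Ne.symm hwx))).of_unique_binary huniq hαψ hs).resolve_left
        (h.negLit_ne h3 hx hw)
    refine ⟨fun hsx => absurd hsx (h.not_litSat hw hx hwx hβ hsw), fun hsg => ?_⟩
    exact absurd hsw (litSat_negLit.1
      (hgw.litSat (fun C hC => hβ C (hψφ hC)) hsg))

lemma IsMinimal.singleton_notMem {φ : CNF V} {X : Finset (Lit V)} (h : IsMinimal φ X)
    (l : Lit V) : {l} ∉ φ := by
  intro hl
  have h1 := h.card_le (h.1.assign_of_unit hl) rfl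
  have h2 := card_assign_le φ l
  have h3 : 0 < (φ.filter fun C => l ∈ C).card :=
    Finset.card_pos.2 ⟨{l}, Finset.mem_filter.2 ⟨hl, by simp⟩⟩
  omega

lemma IsMinimal.two_le_card_negOcc {φ ψ : CNF V} {X : Finset (Lit V)} (h : IsMinimal φ X)
    (h3 : 3 ≤ X.card) {x : Lit V} (hx : x ∈ X) (hψφ : ψ ⊆ φ)
    (hup : ∀ m, UP φ x m → UP ψ x m) : 2 ≤ (negOcc ψ x).card := by
  by_contra! hlt
  obtain ⟨χ, Y, hχ, hY, hlt⟩ := h.1.exists_smaller_of_unique h3 h.singleton_notMem hx hψφ hup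
    (by omega)
  exact absurd (h.card_le hχ hY) (by omega)

/-- If an input has at most one negative occurrence, the encoding can be made smaller. -/
lemma IsLitPEncoding.exists_smaller {φ : CNF V} {X : Finset (Lit V)}
    (h : IsLitPEncoding φ X) (h3 : 3 ≤ X.card) {x : Lit V} (hx : x ∈ X)
    (hφ : (negOcc φ x).card ≤ 1) :
    ∃ (ψ : CNF V) (Y : Finset (Lit V)), IsLitPEncoding ψ Y ∧ Y.card = X.card ∧
      ψ.card < φ.card := by
  by_cases hunit : ∃ l, {l} ∈ φ
  · obtain ⟨l, hl⟩ := hunit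
    refine ⟨_, X, h.assign_of_unit hl, rfl, ?_⟩
    have h2 := card_assign_le φ l
    have h3 : 0 < (φ.filter fun C => l ∈ C).card :=
      Finset.card_pos.2 ⟨{l}, Finset.mem_filter.2 ⟨hl, by simp⟩⟩
    omega
  · exact h.exists_smaller_of_unique h3 (not_exists.1 hunit) hx subset_rfl (fun _ => id) hφ

/-- In a minimal encoding, an input with exactly two negative occurrences has them in binary
clauses. -/
lemma IsMinimal.eq_pair {φ : CNF V} {X : Finset (Lit V)} (h : IsMinimal φ X)
    (h3 : 3 ≤ X.card) {x : Lit V} (hx : x ∈ X) (hQ : (negOcc φ x).card = 2) {C : Clause V}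
    (hC : C ∈ negOcc φ x) : ∃ g, C = {negLit x, g} ∧ g.1 ≠ x.1 := by
  by_contra hcon
  obtain ⟨hCφ, hxC⟩ := mem_negOcc.1 hC
  have hup : ∀ m, UP φ x m → UP (φ.erase C) x m := by
    intro m hm
    induction hm with
    | start => exact .start
    | @unit D m hD hm hup ih =>
      by_cases hDC : D = C
      · subst hDC
        have hmx : m ≠ negLit x := by
          rintro rfl
          exact h.1.not_up_both hx .start (.unit hD hm hup)
        by_cases hmx' : m = x
        · exact hmx' ▸ .start
        exfalso
        have hvar : m.1 ≠ x.1 := by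
          intro e
          rcases eq_or_eq_negLit_of_fst_eq e with e | e
          exacts [hmx' e, hmx e]
        have hsub : {negLit x, m} ⊆ D := by
          intro k hk
          rw [Finset.mem_insert, Finset.mem_singleton] at hk
          rcases hk with rfl | rfl
          exacts [hxC, hm]
        have hss : {negLit x, m} ⊂ D :=
          hsub.ssubset_of_ne fun e => hcon ⟨m, e.symm, hvar⟩
        let ψ : CNF V := insert {negLit x, m} (φ.erase D)
        have hsat : ∀ α : V → Bool, CnfSat α φ → CnfSat α ψ := by
          intro α hα E hE
          rcases Finset.mem_insert.1 hE with rfl | hE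
          · by_cases hs : LitSat α x
            · exact ⟨m, by simp, (UP.unit hD hm hup).litSat hα hs⟩
            · exact ⟨negLit x, by simp, litSat_negLit.2 hs⟩
          · exact hα E (Finset.mem_of_mem_erase hE)
        have hψX : IsLitPEncoding ψ X := by
          refine ⟨fun v hv => ?_, fun v hv w hw hvw => ?_⟩
          · obtain ⟨α, hα, hs⟩ := h.1.1 v hv
            exact ⟨α, hsat α hα, hs⟩
          · obtain ⟨α, hα, hs⟩ := h.1.1 v hv
            refine (h.1.2 v hv w hw hvw).mono (fun E hE => ?_) (hsat α hα) hs
            by_cases hED : E = D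
            · exact ⟨_, Finset.mem_insert_self _ _, hED ▸ hsub⟩
            · exact ⟨E, Finset.mem_insert_of_mem (Finset.mem_erase.2 ⟨hED, hE⟩), subset_rfl⟩
        have hle : ψ.card ≤ φ.card := by
          have h1 : ψ.card ≤ (φ.erase D).card + 1 := Finset.card_insert_le _ _
          have h2 := Finset.card_erase_add_one hD
          omega
        obtain ⟨h1, h2⟩ := h.2 ψ X hψX rfl
        have h4 := h2 (le_antisymm hle h1)
        have h5 : ∑ E ∈ ψ, E.card ≤ ({negLit x, m} : Clause V).card + ∑ E ∈ φ.erase D, E.card := by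
          by_cases hmem : {negLit x, m} ∈ φ.erase D
          · rw [show ψ = φ.erase D from Finset.insert_eq_of_mem hmem]
            exact Nat.le_add_left _ _
          · exact (Finset.sum_insert hmem).le
        have h6 := Finset.add_sum_erase φ Finset.card hD
        have h7 := Finset.card_lt_card hss
        omega
      · exact .unit (Finset.mem_erase.2 ⟨hDC, hD⟩) hm ih
  have h2 := h.two_le_card_negOcc h3 hx (Finset.erase_subset _ _) hup
  have hlt : (negOcc (φ.erase C) x).card < (negOcc φ x).card := by
    refine Finset.card_lt_card ⟨Finset.filter_subset_filter _ (Finset.erase_subset _ _),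
      fun hsub => ?_⟩
    simpa using (mem_negOcc.1 (hsub hC)).1
  omega

/-- Either one input can be dropped at the cost of three clauses, or all negative occurrences
of inputs are in binary clauses, two for each input, whose other literal is not an input. -/
lemma IsMinimal.exists_smaller_or_regular {φ : CNF V} {X : Finset (Lit V)}
    (h : IsMinimal φ X) (h4 : 4 ≤ X.card) :
    (∃ (ψ : CNF V) (Y : Finset (Lit V)), IsLitPEncoding ψ Y ∧ Y.card + 1 = X.card ∧
      ψ.card + 3 ≤ φ.card) ∨
    ∀ x ∈ X, (negOcc φ x).card = 2 ∧
      ∀ C ∈ negOcc φ x, ∃ g, C = {negLit x, g} ∧ g.1 ≠ x.1 ∧ ∀ v ∈ X, g ≠ negLit v := by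
  by_contra! hcon
  obtain ⟨hred, x, hx, hreg⟩ := hcon
  have hass := h.1.assign_negLit hx
  have hcard := Finset.card_erase_add_one hx
  have hle : (assign φ (negLit x)).card + (negOcc φ x).card ≤ φ.card :=
    card_assign_le φ (negLit x)
  have hQ2 := h.two_le_card_negOcc (by omega) hx subset_rfl fun _ => id
  have hQ : (negOcc φ x).card = 2 := by
    have := hred _ _ hass hcard
    omega
  obtain ⟨C, hC, hCg⟩ := hreg hQ
  obtain ⟨g, rfl, hgx⟩ := h.eq_pair (by omega) hx hQ hC
  obtain ⟨v, hv, rfl⟩ := hCg g rfl hgx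
  have hvx : v ≠ x := by
    rintro rfl
    exact hgx rfl
  have hCφ := (mem_negOcc.1 hC).1
  have hQv : (negOcc φ v).card = 2 := by
    have h1 := hred _ _ (h.1.assign_negLit hv) (Finset.card_erase_add_one hv)
    have h2 : (assign φ (negLit v)).card + (negOcc φ v).card ≤ φ.card :=
      card_assign_le φ (negLit v)
    have h3 := h.two_le_card_negOcc (by omega) hv subset_rfl fun _ => id
    omega
  have hone : (negOcc (assign φ (negLit x)) v).card ≤ 1 := by
    have hsub : negOcc (assign φ (negLit x)) v ⊆
        ((negOcc φ v).erase {negLit x, negLit v}).image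
          fun C => C.erase (negLit (negLit x)) := by
      intro D hD
      obtain ⟨hD, hvD⟩ := mem_negOcc.1 hD
      obtain ⟨E, hE, rfl⟩ := Finset.mem_image.1 hD
      obtain ⟨hE, hxE⟩ := Finset.mem_filter.1 hE
      refine Finset.mem_image.2 ⟨E, Finset.mem_erase.2 ⟨?_, mem_negOcc.2
        ⟨hE, Finset.mem_of_mem_erase hvD⟩⟩, rfl⟩
      rintro rfl
      exact hxE (by simp)
    have h1 := Finset.card_le_card hsub
    have h2 := Finset.card_image_le (s := (negOcc φ v).erase {negLit x, negLit v})
      (f := fun C => C.erase (negLit (negLit x)))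
    have h3 := Finset.card_erase_add_one (s := negOcc φ v) (a := {negLit x, negLit v})
      (mem_negOcc.2 ⟨hCφ, by simp⟩)
    omega
  obtain ⟨ψ, Y, hψ, hY, hlt⟩ := hass.exists_smaller (by omega)
    (Finset.mem_erase.2 ⟨hvx, hv⟩) hone
  have := hred ψ Y hψ (by omega)
  omega

/-- The clauses of `φ` containing no negation of a literal in `X`. -/
def nonInputClauses (φ : CNF V) (X : Finset (Lit V)) : CNF V :=
  φ.filter fun C => ∀ v ∈ X, negLit v ∉ C

/-- The negative occurrences of the input literals in `X` are exactly the binary clauses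
`¬x ∨ t` with `x ∈ X` and `t ∈ e x`, where `e x` consists of two literals that are not on
inputs. -/
def IsRegularEncoding (φ : CNF V) (X : Finset (Lit V)) (e : Lit V → Finset (Lit V)) : Prop :=
  ∀ x ∈ X, (e x).card = 2 ∧ negOcc φ x = (e x).image (fun t => {negLit x, t}) ∧
    ∀ t ∈ e x, ∀ v ∈ X, t ≠ v ∧ t ≠ negLit v

lemma IsLitPEncoding.exists_isRegularEncoding {φ : CNF V} {X : Finset (Lit V)}
    (h : IsLitPEncoding φ X)
    (hreg : ∀ x ∈ X, (negOcc φ x).card = 2 ∧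
      ∀ C ∈ negOcc φ x, ∃ g, C = {negLit x, g} ∧ g.1 ≠ x.1 ∧ ∀ v ∈ X, g ≠ negLit v) :
    ∃ e, IsRegularEncoding φ X e := by
  have key : ∀ x ∈ X, ∃ s : Finset (Lit V), s.card = 2 ∧
      negOcc φ x = s.image (fun t => {negLit x, t}) ∧
      ∀ t ∈ s, ∀ v ∈ X, t ≠ v ∧ t ≠ negLit v := by
    intro x hx
    obtain ⟨hcard, hC⟩ := hreg x hx
    obtain ⟨C, D, hCD, hQ⟩ := Finset.card_eq_two.1 hcard
    obtain ⟨g, rfl, hg, hg'⟩ := hC C (by simp [hQ])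
    obtain ⟨k, rfl, hk, hk'⟩ := hC D (by simp [hQ])
    have hgk : g ≠ k := by
      rintro rfl
      exact hCD rfl
    have hne : ∀ t, {negLit x, t} ∈ φ → t.1 ≠ x.1 → ∀ v ∈ X, t ≠ v := by
      rintro t ht htx v hv rfl
      obtain ⟨α, hα, hs⟩ := h.1 x hx
      have hxt : x ≠ t := fun e => htx (by rw [e])
      obtain ⟨m, hm, hsm⟩ := hα _ ht
      rw [Finset.mem_insert, Finset.mem_singleton] at hm
      rcases hm with rfl | rfl
      · exact litSat_negLit.1 hsm hs
      · exact h.not_litSat hx hv hxt hα hs hsm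
    refine ⟨{g, k}, Finset.card_pair hgk, ?_, ?_⟩
    · rw [hQ, Finset.image_insert, Finset.image_singleton]
    · intro t ht v hv
      rw [Finset.mem_insert, Finset.mem_singleton] at ht
      rcases ht with rfl | rfl
      · exact ⟨hne t (mem_negOcc (x := x).1 (by simp [hQ])).1 hg v hv, hg' v hv⟩
      · exact ⟨hne t (mem_negOcc (x := x).1 (by simp [hQ])).1 hk v hv, hk' v hv⟩
  choose! e he using key
  exact ⟨e, he⟩

namespace IsRegularEncoding

variable {φ : CNF V} {X : Finset (Lit V)} {e : Lit V → Finset (Lit V)}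

lemma up_of_mem (hr : IsRegularEncoding φ X e) {x t : Lit V} (hx : x ∈ X) (ht : t ∈ e x) :
    UP φ x t := by
  have hC : {negLit x, t} ∈ negOcc φ x :=
    (hr x hx).2.1 ▸ Finset.mem_image_of_mem (fun t => ({negLit x, t} : Clause V)) ht
  refine .unit (mem_negOcc.1 hC).1 (by simp) fun m hm hmt => ?_
  rw [Finset.mem_insert, Finset.mem_singleton] at hm
  rw [hm.resolve_right hmt, negLit_negLit]
  exact .start

lemma exists_up_negLit (hr : IsRegularEncoding φ X e) (h : IsLitPEncoding φ X) (h3 : 3 ≤ X.card)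
    {x v : Lit V} (hx : x ∈ X) (hv : v ∈ X) (hxv : x ≠ v) :
    ∃ t ∈ e v, UP φ x (negLit t) := by
  have hup := h.2 x hx v hv hxv
  generalize hw : negLit v = w at hup
  cases hup with
  | start => exact absurd hw (h.negLit_ne h3 hx hv)
  | @unit C _ hC hl hCl =>
    subst hw
    have hCv := mem_negOcc.2 ⟨hC, hl⟩
    rw [(hr v hv).2.1] at hCv
    obtain ⟨t, ht, rfl⟩ := Finset.mem_image.1 hCv
    exact ⟨t, ht, hCl t (by simp) ((hr v hv).2.2 t ht v hv).2⟩

/-- Each derived literal not stemming from the negative occurrences of inputs needs a clause of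
its own. -/
lemma card_le (hr : IsRegularEncoding φ X e) (h : IsLitPEncoding φ X) {x : Lit V} (hx : x ∈ X)
    {M : Finset (Lit V)}
    (hM : ∀ m ∈ M, UP φ x m ∧ m ∉ e x ∧ m ≠ x ∧ ∀ v ∈ X, m ≠ negLit v) :
    M.card ≤ (nonInputClauses φ X).card := by
  refine Finset.card_le_card_of_forall_subsingleton
    (fun m C => m ∈ C ∧ ∀ k ∈ C, k ≠ m → UP φ x (negLit k)) ?_ ?_
  · intro m hm
    obtain ⟨hup, hme, hmx, hmv⟩ := hM m hm
    cases hup with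
    | start => exact absurd rfl hmx
    | @unit C _ hC hl hCl =>
      refine ⟨C, Finset.mem_filter.2 ⟨hC, fun v hv hvC => ?_⟩, hl, hCl⟩
      have hvx : v = x := by
        by_contra hvx
        have hupv := hCl _ hvC (hmv v hv).symm
        rw [negLit_negLit] at hupv
        exact h.not_up_both hx hupv (h.2 x hx v hv (Ne.symm hvx))
      subst hvx
      have hCv := mem_negOcc.2 ⟨hC, hvC⟩
      rw [(hr v hv).2.1] at hCv
      obtain ⟨t, ht, rfl⟩ := Finset.mem_image.1 hCv
      rw [Finset.mem_insert, Finset.mem_singleton] at hl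
      rcases hl with rfl | rfl
      · exact hmv v hv rfl
      · exact hme ht
  · rintro C - m ⟨hm, hmC, hmup⟩ k ⟨hk, hkC, -⟩
    by_contra hmk
    exact h.not_up_both hx (hM k hk).1 (hmup k hkC (Ne.symm hmk))

lemma two_mul_card_add_le (hr : IsRegularEncoding φ X e) :
    2 * X.card + (nonInputClauses φ X).card ≤ φ.card := by
  have hdisj : (X : Set (Lit V)).PairwiseDisjoint (negOcc φ) := by
    intro x hx v hv hxv
    refine Finset.disjoint_left.2 fun C hCx hCv => ?_
    have hvC := (mem_negOcc.1 hCv).2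
    rw [(hr x hx).2.1] at hCx
    obtain ⟨t, ht, rfl⟩ := Finset.mem_image.1 hCx
    rw [Finset.mem_insert, Finset.mem_singleton] at hvC
    rcases hvC with e' | e'
    · exact hxv (negLit_injective e').symm
    · exact ((hr x hx).2.2 t ht v hv).2 e'.symm
  have h1 : (X.biUnion (negOcc φ)).card = 2 * X.card := by
    rw [Finset.card_biUnion hdisj, Finset.sum_congr rfl (g := fun _ => 2), Finset.sum_const,
      smul_eq_mul, mul_comm]
    intro x hx
    obtain ⟨hcard, himg, hne⟩ := hr x hx
    rw [himg, Finset.card_image_of_injOn, hcard]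
    intro t ht s hs hts
    have : t ∈ ({negLit x, s} : Clause V) := by
      rw [← show ({negLit x, t} : Clause V) = {negLit x, s} from hts]
      simp
    rw [Finset.mem_insert, Finset.mem_singleton] at this
    exact this.resolve_left (hne t ht x hx).2
  have h2 : Disjoint (X.biUnion (negOcc φ)) (nonInputClauses φ X) := by
    refine Finset.disjoint_left.2 fun C hC hC' => ?_
    obtain ⟨v, hv, hCv⟩ := Finset.mem_biUnion.1 hC
    exact (Finset.mem_filter.1 hC').2 v hv (mem_negOcc.1 hCv).2
  rw [← h1, ← Finset.card_union_of_disjoint h2]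
  refine Finset.card_le_card (Finset.union_subset ?_ (Finset.filter_subset _ _))
  exact Finset.biUnion_subset.2 fun v _ => Finset.filter_subset _ _

/-- The literals falsified by `x` form a vertex cover of the graph with the edges `e v`,
`v ≠ x`. -/
lemma card_le_of_degree_le (hr : IsRegularEncoding φ X e) (h : IsLitPEncoding φ X) (h3 : 3 ≤ X.card)
    {d : ℕ} (hd : ∀ t, (X.filter fun v => t ∈ e v).card ≤ d) :
    X.card ≤ ((nonInputClauses φ X).card + 2) * d + 1 := by
  classical
  obtain ⟨x, hx⟩ := Finset.card_pos.1 (by omega : 0 < X.card)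
  set T := (X.biUnion e).filter fun t => UP φ x (negLit t)
  have hTcard : T.card ≤ (nonInputClauses φ X).card + 2 := by
    have h1 : (T.image negLit \ e x).card ≤ _ := hr.card_le h hx (by
      intro m hm
      obtain ⟨hm, hme⟩ := Finset.mem_sdiff.1 hm
      obtain ⟨t, ht, rfl⟩ := Finset.mem_image.1 hm
      obtain ⟨ht, hup⟩ := Finset.mem_filter.1 ht
      obtain ⟨v, hv, htv⟩ := Finset.mem_biUnion.1 ht
      refine ⟨hup, hme, fun e' => ?_, fun w hw e' => ?_⟩
      · exact ((hr v hv).2.2 t htv x hx).2 (by rw [← e', negLit_negLit])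
      · exact ((hr v hv).2.2 t htv w hw).1 (negLit_injective e'))
    have h2 := Finset.card_le_card_sdiff_add_card (s := T.image negLit) (t := e x)
    rw [Finset.card_image_of_injective _ negLit_injective, (hr x hx).1] at h2
    omega
  have hcover : X.erase x ⊆ T.biUnion fun t => X.filter fun v => t ∈ e v := by
    intro v hv
    obtain ⟨hvx, hv⟩ := Finset.mem_erase.1 hv
    obtain ⟨t, ht, hup⟩ := hr.exists_up_negLit h h3 hx hv (Ne.symm hvx)
    exact Finset.mem_biUnion.2 ⟨t, Finset.mem_filter.2 ⟨Finset.mem_biUnion.2 ⟨v, hv, ht⟩, hup⟩,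
      Finset.mem_filter.2 ⟨hv, ht⟩⟩
  have h1 := (Finset.card_le_card hcover).trans
    (Finset.card_biUnion_le_card_mul _ _ d fun t _ => hd t)
  have h2 := Nat.mul_le_mul_right d hTcard
  have h4 := Finset.card_erase_add_one hx
  omega

lemma degree_le (hr : IsRegularEncoding φ X e) (h : IsLitPEncoding φ X) (h3 : 3 ≤ X.card)
    {t : Lit V} (ht : 3 ≤ (X.filter fun v => t ∈ e v).card) :
    (X.filter fun v => t ∈ e v).card ≤
      (nonInputClauses φ X).card + 1 := by
  set star := X.filter fun v => t ∈ e v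
  have key : ∀ v ∈ star, ∃ o, e v = {t, o} := by
    intro v hv
    obtain ⟨hv, htv⟩ := Finset.mem_filter.1 hv
    obtain ⟨a, b, -, hab⟩ := Finset.card_eq_two.1 (hr v hv).1
    rw [hab, Finset.mem_insert, Finset.mem_singleton] at htv
    rcases htv with rfl | rfl
    exacts [⟨b, hab⟩, ⟨a, hab.trans (Finset.pair_comm _ _)⟩]
  choose! o ho using key
  have hstar : ∀ {v}, v ∈ star → v ∈ X := fun hv => (Finset.mem_filter.1 hv).1
  have hoe : ∀ {v}, v ∈ star → o v ∈ e v := fun hv => by simp [ho _ hv]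
  have hup : ∀ {v}, v ∈ star → UP φ v (o v) := fun hv => hr.up_of_mem (hstar hv) (hoe hv)
  have hupt : ∀ {v}, v ∈ star → UP φ v t := fun hv =>
    hr.up_of_mem (hstar hv) (Finset.mem_filter.1 hv).2
  have hneg : ∀ {v w}, v ∈ star → w ∈ star → v ≠ w → UP φ v (negLit (o w)) := by
    intro v w hv hw hvw
    obtain ⟨s, hs, hsup⟩ := hr.exists_up_negLit h h3 (hstar hv) (hstar hw) hvw
    rw [ho w hw, Finset.mem_insert, Finset.mem_singleton] at hs
    rcases hs with rfl | rfl
    · exact (h.not_up_both (hstar hv) (hupt hv) hsup).elim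
    · exact hsup
  obtain ⟨u, hu⟩ := Finset.card_pos.1 (by omega : 0 < star.card)
  have hinj : Set.InjOn (fun v => negLit (o v)) (star.erase u) := by
    intro v hv w hw hvw
    by_contra hne
    have hv := Finset.mem_of_mem_erase hv
    have hw := Finset.mem_of_mem_erase hw
    have := hneg hv hw hne
    rw [← negLit_injective hvw] at this
    exact h.not_up_both (hstar hv) (hup hv) this
  have hcard := hr.card_le h (hstar hu) (M := (star.erase u).image fun v => negLit (o v)) (by
    intro m hm
    obtain ⟨v, hv, rfl⟩ := Finset.mem_image.1 hm
    obtain ⟨hvu, hv⟩ := Finset.mem_erase.1 hv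
    have hov := (hr v (hstar hv)).2.2 (o v) (hoe hv)
    refine ⟨hneg hu hv (Ne.symm hvu), fun hmem => ?_, fun e' => ?_, fun w hw e' => ?_⟩
    · rw [ho u hu, Finset.mem_insert, Finset.mem_singleton] at hmem
      rcases hmem with e' | e'
      · exact h.not_up_both (hstar hv) (hup hv) (e' ▸ hupt hv)
      · obtain ⟨w, hw, hwn⟩ : ∃ w ∈ star, w ∉ ({u, v} : Finset (Lit V)) :=
          Finset.exists_mem_notMem_of_card_lt_card (lt_of_le_of_lt Finset.card_le_two ht)
        simp only [Finset.mem_insert, Finset.mem_singleton, not_or] at hwn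
        exact h.not_up_both (hstar hw) (e' ▸ hneg hw hv hwn.2) (hneg hw hu hwn.1)
    · exact (hov u (hstar hu)).2 (by rw [← e', negLit_negLit])
    · exact (hov w hw).1 (negLit_injective e'))
  rw [Finset.card_image_of_injOn hinj] at hcard
  have := Finset.card_erase_add_one hu
  omega

lemma card_le_sq (hr : IsRegularEncoding φ X e) (h : IsLitPEncoding φ X) (h9 : 9 ≤ X.card) :
    X.card ≤ ((nonInputClauses φ X).card + 2) ^ 2 := by
  have h1 := hr.card_le_of_degree_le h (by omega)
    (d := max 2 ((nonInputClauses φ X).card + 1)) fun t => by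
      by_cases ht : 3 ≤ (X.filter fun v => t ∈ e v).card
      · exact (hr.degree_le h (by omega) ht).trans (le_max_right _ _)
      · exact le_max_of_le_left (by omega)
  generalize (nonInputClauses φ X).card = r at h1 ⊢
  rcases Nat.eq_zero_or_pos r with rfl | hpos
  · norm_num at h1
    omega
  · rw [max_eq_right (by omega)] at h1
    nlinarith

end IsRegularEncoding

theorem IsLitPEncoding.card_bound {n : ℕ} (hn : 3 ≤ n) :
    ∀ (φ : CNF V) (X : Finset (Lit V)), IsLitPEncoding φ X → X.card = n →
      (n ≤ 8 → 3 * n ≤ φ.card + 8) ∧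
        (9 ≤ n → ∃ s, 2 * n + s ≤ φ.card + 2 ∧ n ≤ s ^ 2) := by
  induction n, hn using Nat.le_induction with
  | base =>
    intro φ X h hX
    obtain ⟨ψ, Y, hmin, hY, hle⟩ := h.exists_isMinimal
    obtain ⟨x, hx⟩ := Finset.card_pos.1 (by omega : 0 < Y.card)
    have h1 := hmin.two_le_card_negOcc (by omega) hx subset_rfl fun _ => id
    have h2 : (negOcc ψ x).card ≤ ψ.card := Finset.card_filter_le _ _
    exact ⟨fun _ => by omega, fun h9 => by omega⟩
  | succ n hn ih =>
    intro φ X h hX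
    obtain ⟨ψ, Y, hmin, hY, hle⟩ := h.exists_isMinimal
    rcases hmin.exists_smaller_or_regular (by omega) with ⟨χ, Z, hχ, hZ, hlt⟩ | hreg
    · obtain ⟨h1, h2⟩ := ih χ Z hχ (by omega)
      refine ⟨fun h8 => ?_, fun h9 => ?_⟩
      · have := h1 (by omega)
        omega
      · by_cases h9' : 9 ≤ n
        · obtain ⟨s, hs, hns⟩ := h2 h9'
          exact ⟨s + 1, by omega, by nlinarith⟩
        · have := h1 (by omega)
          exact ⟨3, by omega, by omega⟩
    · obtain ⟨e, he⟩ := hmin.1.exists_isRegularEncoding hreg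
      have h1 := he.two_mul_card_add_le
      refine ⟨fun h8 => by omega, fun h9 => ?_⟩
      have h2 := he.card_le_sq hmin.1 (by omega)
      exact ⟨(nonInputClauses ψ Y).card + 2, by omega, by omega⟩

lemma UnitDerives.exists_up {φ : CNF V} {u : Lit V} {C : Clause V}
    (h : UnitDerives (addUnits φ {u}) C) :
    ∃ D ∈ addUnits φ {u}, C ⊆ D ∧ ∀ l ∈ D, l ∉ C → UP φ u (negLit l) := by
  induction h with
  | @base C h => exact ⟨C, h, subset_rfl, fun l hl hn => absurd hl hn⟩
  | @step l C _ _ _ ih1 ih2 =>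
    obtain ⟨D, hD, hlD, hup⟩ := ih1
    obtain ⟨E, hE, hCE, hupE⟩ := ih2
    have hl : UP φ u l := by
      simp only [addUnits, Finset.image_singleton, Finset.mem_union, Finset.mem_singleton] at hD
      rcases hD with hD | rfl
      · exact .unit hD (Finset.singleton_subset_iff.1 hlD) fun m hm hml =>
          hup m hm (by simpa using hml)
      · rw [Finset.singleton_subset_iff, Finset.mem_singleton] at hlD
        exact hlD ▸ .start
    refine ⟨E, hE, (Finset.erase_subset _ _).trans hCE, fun k hk hkC => ?_⟩
    by_cases hkl : k = negLit l
    · rwa [hkl, negLit_negLit]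
    · exact hupE k hk fun hkC' => hkC (Finset.mem_erase.2 ⟨hkl, hkC'⟩)

lemma UnitDerives.up {φ : CNF V} {u l : Lit V} (h : UnitDerives (addUnits φ {u}) {l}) :
    UP φ u l := by
  obtain ⟨D, hD, hlD, hup⟩ := h.exists_up
  rw [Finset.singleton_subset_iff] at hlD
  simp only [addUnits, Finset.image_singleton, Finset.mem_union, Finset.mem_singleton] at hD
  rcases hD with hD | rfl
  · exact .unit hD hlD fun m hm hml => hup m hm (by simpa using hml)
  · exact Finset.mem_singleton.1 hlD ▸ .start

lemma not_unitDerives_empty {φ : CNF V} {u : Lit V} {α : V → Bool} (hα : CnfSat α φ)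
    (hu : LitSat α u) : ¬ UnitDerives (addUnits φ {u}) ∅ := by
  intro h
  obtain ⟨D, hD, -, hup⟩ := h.exists_up
  have hsat : ClauseSat α D := by
    simp only [addUnits, Finset.image_singleton, Finset.mem_union, Finset.mem_singleton] at hD
    rcases hD with hD | rfl
    · exact hα D hD
    · exact ⟨u, by simp, hu⟩
  obtain ⟨l, hl, hs⟩ := hsat
  exact litSat_negLit.1 ((hup l hl (by simp)).litSat hα hu) hs

end UnitPropagation

lemma IsPCEncoding.isLitPEncoding {n ℓ : ℕ} {φ : CNF (Var n ℓ)} {f : (Fin n → Bool) → Prop}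
    (h : IsPCEncoding φ f) (hf : ∀ i, f fun j => decide (j = i)) (hamo : ∀ α, f α → AMO n α) :
    IsLitPEncoding φ (Finset.univ.image fun i : Fin n => (inLit i true : Lit (Var n ℓ))) := by
  have hmodel : ∀ i : Fin n, ∃ α : Var n ℓ → Bool, CnfSat α φ ∧ LitSat α (inLit i true) := by
    intro i
    obtain ⟨β, hβ⟩ := (h.1.2 _).1 (hf i)
    exact ⟨_, hβ, by simp [LitSat, inLit]⟩
  refine ⟨fun x hx => ?_, fun x hx v hv hxv => ?_⟩
  · obtain ⟨i, -, rfl⟩ := Finset.mem_image.1 hx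
    exact hmodel i
  · obtain ⟨i, -, rfl⟩ := Finset.mem_image.1 hx
    obtain ⟨j, -, rfl⟩ := Finset.mem_image.1 hv
    have hij : i ≠ j := fun e => hxv (by rw [e])
    obtain ⟨α, hα, hs⟩ := hmodel i
    have hpc := h.2 {(i, true)} (Finset.singleton_nonempty _) (j, false) (by
      intro β hβ hi
      have hi : β i = true := hi _ (Finset.mem_singleton_self _)
      by_contra hj
      have hj : β j = true := by simpa using hj
      exact hij (Finset.card_le_one.1 (hamo β hβ) i (by simp [hi]) j (by simp [hj])))
    rw [inLits, Finset.image_singleton] at hpc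
    exact (hpc.resolve_right (not_unitDerives_empty hα hs)).up

lemma IsPCEncoding.card_ge {n ℓ : ℕ} (hn : 9 ≤ n) {φ : CNF (Var n ℓ)}
    {f : (Fin n → Bool) → Prop} (h : IsPCEncoding φ f) (hf : ∀ i, f fun j => decide (j = i))
    (hamo : ∀ α, f α → AMO n α) : 2 * (n : ℝ) + Real.sqrt n - 2 ≤ (φ.card : ℝ) := by
  have hcard : (Finset.univ.image fun i : Fin n => (inLit i true : Lit (Var n ℓ))).card = n := by
    rw [Finset.card_image_of_injective, Finset.card_univ, Fintype.card_fin]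
    intro i j hij
    simpa [inLit] using hij
  obtain ⟨s, hs, hns⟩ := ((h.isLitPEncoding hf hamo).card_bound (by omega) _ _ hcard).2 hn
  have hsqrt : Real.sqrt n ≤ s := Real.sqrt_le_iff.2 ⟨s.cast_nonneg, by exact_mod_cast hns⟩
  have hs' : 2 * (n : ℝ) + s ≤ φ.card + 2 := by exact_mod_cast hs
  linarith

/-- For every n ≥ 9, every propagation complete encoding of AMO_n has at
least 2n + √n − 2 clauses, and every propagation complete encoding of EXO_n has at
least 2n + √n − 2 clauses. -/
theorem pc_encoding_amo_exo_lower_bound (n : ℕ) (hn : 9 ≤ n) :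
    (∀ ℓ : ℕ, ∀ φ : CNF (Var n ℓ), IsPCEncoding φ (AMO n) →
      (2 * (n : ℝ) + Real.sqrt n - 2) ≤ (φ.card : ℝ)) ∧
    (∀ ℓ : ℕ, ∀ φ : CNF (Var n ℓ), IsPCEncoding φ (EXO n) →
      (2 * (n : ℝ) + Real.sqrt n - 2) ≤ (φ.card : ℝ)) := by
  have hcard : ∀ i : Fin n, (Finset.univ.filter fun j => decide (j = i) = true).card = 1 :=
    fun i => by simp [Finset.filter_eq']
  exact ⟨fun ℓ φ h => h.card_ge hn (fun i => (hcard i).le) fun _ => id,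
    fun ℓ φ h => h.card_ge hn hcard fun _ => le_of_eq⟩
end

section
/- For every n ≥ 9, the minimum size S₂(n) of a 2-CNF p-encoding with n input variables satisfies S₂(n) ≥ 2n + 2√n − 3. -/
namespace TwoCNF

variable {V ι : Type}

@[simp] lemma negLit_negLit (l : Lit V) : negLit (negLit l) = l := by
  simp [negLit]

lemma negLit_inj {a b : Lit V} : negLit a = negLit b ↔ a = b :=
  ⟨fun h => by simpa using congrArg negLit h, congrArg negLit⟩

lemma negLit_eq_comm {a b : Lit V} : negLit a = b ↔ a = negLit b := by
  rw [← negLit_inj, negLit_negLit]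

lemma negLit_ne (a : Lit V) : negLit a ≠ a := by
  intro h
  have := congrArg Prod.snd h
  simp [negLit] at this

lemma not_litSat_negLit {α : V → Bool} {a : Lit V} (h : LitSat α a) : ¬ LitSat α (negLit a) := by
  simp_all [LitSat, negLit]

variable [DecidableEq V]

/-- The arcs of the implication graph of the two-literal clauses of `φ`. -/
def Arc (φ : CNF V) (a b : Lit V) : Prop := ({negLit a, b} : Clause V) ∈ φ

/-- Reachability in the implication graph. -/
def Reach (φ : CNF V) : Lit V → Lit V → Prop := Relation.ReflTransGen (Arc φ)

lemma Arc.contra {φ : CNF V} {a b : Lit V} (h : Arc φ a b) : Arc φ (negLit b) (negLit a) := by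
  unfold Arc at *
  rwa [negLit_negLit, Finset.pair_comm]

lemma Reach.refl {φ : CNF V} (a : Lit V) : Reach φ a a := Relation.ReflTransGen.refl

lemma Reach.trans {φ : CNF V} {a b c : Lit V} (h : Reach φ a b) (h' : Reach φ b c) :
    Reach φ a c := Relation.ReflTransGen.trans h h'

lemma Arc.reach {φ : CNF V} {a b : Lit V} (h : Arc φ a b) : Reach φ a b :=
  Relation.ReflTransGen.single h

lemma Reach.contra {φ : CNF V} {a b : Lit V} (h : Reach φ a b) :
    Reach φ (negLit b) (negLit a) := by
  induction h with
  | refl => exact Reach.refl _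
  | tail _ h ih => exact h.contra.reach.trans ih

lemma Reach.contra' {φ : CNF V} {a b : Lit V} (h : Reach φ a (negLit b)) :
    Reach φ b (negLit a) := by
  simpa using h.contra

lemma Reach.litSat {φ : CNF V} {α : V → Bool} (hα : CnfSat α φ) {a b : Lit V}
    (h : Reach φ a b) (ha : LitSat α a) : LitSat α b := by
  induction h with
  | refl => exact ha
  | tail _ h ih =>
    obtain ⟨l, hl, hs⟩ := hα _ h
    rcases Finset.mem_insert.1 hl with rfl | hl
    · exact absurd hs (not_litSat_negLit ih)
    · rwa [Finset.mem_singleton.1 hl] at hs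

/-- A path survives in `φ'` if all arcs lying between its endpoints do. -/
lemma Reach.restrict {φ φ' : CNF V} {a b : Lit V} (h : Reach φ a b)
    (H : ∀ v w, Reach φ a v → Reach φ w b → Arc φ v w → Reach φ' v w) : Reach φ' a b := by
  suffices ∀ v, Reach φ a v → Reach φ v b → Reach φ' a v from this b h (Reach.refl b)
  intro v hv
  induction hv with
  | refl => exact fun _ => Reach.refl _
  | tail hv hvw ih =>
    intro hw
    exact (ih (hvw.reach.trans hw)).trans (H _ _ hv hw hvw)

/-- A two-literal-clause encoding of pairwise exclusion of the literals `p i`, `i ∈ I`. -/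
structure Enc (φ : CNF V) (I : Finset ι) (p : ι → Lit V) : Prop where
  card_le : ∀ C ∈ φ, C.card ≤ 2
  sat : ∀ i ∈ I, ∃ α : V → Bool, CnfSat α φ ∧ LitSat α (p i)
  reach : ∀ i ∈ I, ∀ j ∈ I, i ≠ j → Reach φ (p i) (negLit (p j))

/-- No clause of `φ` contains an input literal positively. -/
def NoPos (φ : CNF V) (I : Finset ι) (p : ι → Lit V) : Prop := ∀ i ∈ I, ∀ C ∈ φ, p i ∉ C

lemma clause_eq_pair {C : Clause V} (hC : C.card ≤ 2) {a : Lit V} (ha : a ∈ C) :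
    ∃ b, C = {a, b} := by
  have h1 : (C.erase a).card ≤ 1 := by rw [Finset.card_erase_of_mem ha]; omega
  rcases Nat.le_one_iff_eq_zero_or_eq_one.1 h1 with h | h
  · refine ⟨a, ?_⟩
    rw [← Finset.insert_erase ha, Finset.card_eq_zero.1 h]
    simp
  · obtain ⟨b, hb⟩ := Finset.card_eq_one.1 h
    exact ⟨b, by rw [← hb, Finset.insert_erase ha]⟩

lemma pair_right_inj {a b c : Lit V} : ({a, b} : Clause V) = {a, c} ↔ b = c := by
  constructor
  · intro h
    have hb : b ∈ ({a, c} : Clause V) := h ▸ by simp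
    have hc : c ∈ ({a, b} : Clause V) := h ▸ by simp
    simp only [Finset.mem_insert, Finset.mem_singleton] at hb hc
    grind
  · rintro rfl; rfl

namespace Enc

variable {φ : CNF V} {I : Finset ι} {p : ι → Lit V}

lemma not_reach_neg (h : Enc φ I p) {i : ι} (hi : i ∈ I) {a : Lit V}
    (h1 : Reach φ (p i) a) (h2 : Reach φ (p i) (negLit a)) : False := by
  obtain ⟨α, hα, hp⟩ := h.sat i hi
  exact not_litSat_negLit (h1.litSat hα hp) (h2.litSat hα hp)

lemma not_reach (h : Enc φ I p) {i j : ι} (hi : i ∈ I) (hj : j ∈ I) (hij : i ≠ j) :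
    ¬ Reach φ (p i) (p j) := fun h1 => h.not_reach_neg hi h1 (h.reach i hi j hj hij)

lemma not_reach' (h : Enc φ I p) {i j : ι} (hi : i ∈ I) (hj : j ∈ I) (hij : i ≠ j) :
    ¬ Reach φ (negLit (p i)) (negLit (p j)) := fun h1 =>
  h.not_reach hj hi hij.symm (by simpa using h1.contra)

lemma ne_neg (h : Enc φ I p) (h3 : 3 ≤ I.card) {i j : ι} (hi : i ∈ I) (hj : j ∈ I) :
    p i ≠ negLit (p j) := by
  classical
  intro he
  obtain ⟨m, hm, hmn⟩ : ∃ m ∈ I, m ∉ ({i, j} : Finset ι) := by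
    apply Finset.exists_mem_notMem_of_card_lt_card
    exact lt_of_le_of_lt Finset.card_le_two h3
  simp only [Finset.mem_insert, Finset.mem_singleton, not_or] at hmn
  exact h.not_reach hm hi hmn.1 (he ▸ h.reach m hm j hj hmn.2)

/-- Clauses containing an input literal positively are superfluous. -/
lemma filter_noPos [DecidableEq ι] (h : Enc φ I p) :
    Enc (φ.filter fun C => ∀ i ∈ I, p i ∉ C) I p := by
  set φ' := φ.filter fun C => ∀ i ∈ I, p i ∉ C with hφ'
  refine ⟨fun C hC => h.card_le C (Finset.mem_filter.1 hC).1, fun i hi => ?_,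
    fun i hi j hj hij => ?_⟩
  · obtain ⟨α, hα, hp⟩ := h.sat i hi
    exact ⟨α, fun C hC => hα C (Finset.mem_filter.1 hC).1, hp⟩
  · suffices ∀ w, Reach φ (p i) w → Reach φ w (negLit (p j)) →
        Reach φ' (p i) w ∨ Reach φ' (p i) (negLit (p j)) by
      simpa using this _ (h.reach i hi j hj hij) (Reach.refl _)
    intro w hw
    induction hw with
    | refl => exact fun _ => Or.inl (Reach.refl _)
    | @tail v w hv hvw ih =>
      intro hwj
      rcases ih (hvw.reach.trans hwj) with ih | ih
      swap; · exact Or.inr ih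
      by_cases hc : ∀ l ∈ I, p l ∉ ({negLit v, w} : Clause V)
      · exact Or.inl (ih.trans (Arc.reach (Finset.mem_filter.2 ⟨hvw, hc⟩)))
      push Not at hc
      obtain ⟨l, hl, hlc⟩ := hc
      simp only [Finset.mem_insert, Finset.mem_singleton] at hlc
      rcases hlc with hlc | hlc
      · have hv' : v = negLit (p l) := by rw [hlc]; simp
        by_cases hlj : l = j
        · right; rw [hv', hlj] at ih; exact ih
        · exact absurd (hv' ▸ hvw.reach.trans hwj) (h.not_reach' hl hj hlj)
      · by_cases hli : i = l
        · left; rw [← hlc, ← hli]; exact Reach.refl _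
        · exact absurd (hlc ▸ Reach.trans hv hvw.reach) (h.not_reach hi hl hli)

/-- Tautological clauses are superfluous. -/
lemma filter_isClause (h : Enc φ I p) : Enc (φ.filter IsClause) I p := by
  refine ⟨fun C hC => h.card_le C (Finset.mem_filter.1 hC).1, fun i hi => ?_,
    fun i hi j hj hij => ?_⟩
  · obtain ⟨α, hα, hp⟩ := h.sat i hi
    exact ⟨α, fun C hC => hα C (Finset.mem_filter.1 hC).1, hp⟩
  · refine (h.reach i hi j hj hij).restrict fun v w _ _ hvw => ?_
    by_cases hc : IsClause ({negLit v, w} : Clause V)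
    · exact Arc.reach (Finset.mem_filter.2 ⟨hvw, hc⟩)
    · have : v = w := by
        unfold IsClause at hc
        push Not at hc
        obtain ⟨l, hl, hl'⟩ := hc
        simp only [Finset.mem_insert, Finset.mem_singleton] at hl hl'
        rcases hl with rfl | rfl
        · rw [negLit_negLit] at hl'
          rcases hl' with hl' | hl'
          · exact absurd hl'.symm (negLit_ne v)
          · exact hl'
        · rcases hl' with hl' | hl'
          · exact (negLit_inj.1 hl').symm
          · exact absurd hl' (negLit_ne _)
      exact this ▸ Reach.refl _

/-- Deleting the inputs in `B` allows one to drop all clauses containing their negations, and,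
if the literal `negLit y` occurs in no other clauses, also all clauses containing `y`. -/
lemma delete_deadEnd [DecidableEq ι] (h : Enc φ I p) {B : Finset ι} (hB : B ⊆ I) {y : Lit V}
    (hy : ∀ i ∈ I, p i ≠ y ∧ p i ≠ negLit y)
    (hocc : ∀ C ∈ φ, negLit y ∈ C → ∃ j ∈ B, negLit (p j) ∈ C) :
    Enc (φ.filter fun C => y ∉ C ∧ ∀ j ∈ B, negLit (p j) ∉ C) (I \ B) p := by
  refine ⟨fun C hC => h.card_le C (Finset.mem_filter.1 hC).1, fun i hi => ?_,
    fun i hi j hj hij => ?_⟩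
  · obtain ⟨α, hα, hp⟩ := h.sat i (Finset.mem_sdiff.1 hi).1
    exact ⟨α, fun C hC => hα C (Finset.mem_filter.1 hC).1, hp⟩
  · obtain ⟨hi, hiB⟩ := Finset.mem_sdiff.1 hi
    obtain ⟨hj, hjB⟩ := Finset.mem_sdiff.1 hj
    refine (h.reach i hi j hj hij).restrict fun v w hv hw hvw => ?_
    have key1 : ∀ l ∈ B, ¬ Reach φ (p i) (p l) := fun l hl =>
      h.not_reach hi (hB hl) (by rintro rfl; exact hiB hl)
    have key2 : ∀ l ∈ B, ¬ Reach φ (negLit (p l)) (negLit (p j)) := fun l hl =>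
      h.not_reach' (hB hl) hj (by rintro rfl; exact hjB hl)
    refine Arc.reach (Finset.mem_filter.2 ⟨hvw, ?_, ?_⟩)
    · simp only [Finset.mem_insert, Finset.mem_singleton]
      rintro (hyv | hyw)
      · have hv' : v = negLit y := by rw [hyv]; simp
        rw [hv'] at hv
        rcases Relation.ReflTransGen.cases_tail hv with he | ⟨u, hu, huy⟩
        · exact (hy i hi).2 he.symm
        · obtain ⟨l, hl, hlu⟩ := hocc _ huy (by simp)
          simp only [Finset.mem_insert, Finset.mem_singleton, negLit_inj] at hlu
          rcases hlu with rfl | hlu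
          · exact key1 l hl hu
          · exact (hy l (hB hl)).1 hlu
      · rw [← hyw] at hw
        rcases Relation.ReflTransGen.cases_head hw with he | ⟨u, hyu, hu⟩
        · exact (hy j hj).2 (by rw [he]; simp)
        · obtain ⟨l, hl, hlu⟩ := hocc _ hyu (by simp)
          simp only [Finset.mem_insert, Finset.mem_singleton, negLit_inj] at hlu
          rcases hlu with hlu | rfl
          · exact (hy l (hB hl)).1 hlu
          · exact key2 l hl hu
    · intro l hl
      simp only [Finset.mem_insert, Finset.mem_singleton, negLit_inj]
      rintro (rfl | rfl)
      · exact key1 l hl hv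
      · exact key2 l hl hw

/-- Deleting a single input. -/
lemma delete [DecidableEq ι] (h : Enc φ I p) {l : ι} (hl : l ∈ I) :
    Enc (φ.filter fun C => negLit (p l) ∉ C) (I.erase l) p := by
  refine ⟨fun C hC => h.card_le C (Finset.mem_filter.1 hC).1, fun i hi => ?_,
    fun i hi j hj hij => ?_⟩
  · obtain ⟨α, hα, hp⟩ := h.sat i (Finset.mem_erase.1 hi).2
    exact ⟨α, fun C hC => hα C (Finset.mem_filter.1 hC).1, hp⟩
  · obtain ⟨hil, hi⟩ := Finset.mem_erase.1 hi
    obtain ⟨hjl, hj⟩ := Finset.mem_erase.1 hj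
    refine (h.reach i hi j hj hij).restrict fun v w hv hw hvw => ?_
    refine Arc.reach (Finset.mem_filter.2 ⟨hvw, ?_⟩)
    simp only [Finset.mem_insert, Finset.mem_singleton, negLit_inj]
    rintro (rfl | rfl)
    · exact h.not_reach hi hl hil hv
    · exact h.not_reach' hl hj hjl.symm hw

lemma eq_of_reach (hn : NoPos φ I p) {l : ι} (hl : l ∈ I) {a : Lit V}
    (ha : Reach φ a (p l)) : a = p l := by
  rcases Relation.ReflTransGen.cases_tail ha with he | ⟨u, _, hu⟩
  · exact he.symm
  · exact absurd (by simp) (hn l hl _ hu)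

lemma eq_of_reach' (hn : NoPos φ I p) {l : ι} (hl : l ∈ I) {a : Lit V}
    (ha : Reach φ (negLit (p l)) a) : a = negLit (p l) := by
  have := eq_of_reach hn hl (by simpa using ha.contra)
  exact negLit_eq_comm.1 this

/-- An input with only one outgoing clause can be replaced by the other literal of this clause. -/
lemma contract [DecidableEq ι] (h : Enc φ I p) (hn : NoPos φ I p) (h3 : 3 ≤ I.card) {l : ι}
    (hl : l ∈ I) (hQ : (φ.filter fun C => negLit (p l) ∈ C).card ≤ 1) :
    ∃ (φ' : CNF V) (p' : ι → Lit V), Enc φ' I p' ∧ φ'.card < φ.card := by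
  obtain ⟨j₀, hj₀, hjl⟩ := Finset.exists_mem_ne (by omega : 1 < I.card) l
  have head : ∀ j ∈ I, j ≠ l → ∃ z, Arc φ (p l) z ∧ Reach φ z (negLit (p j)) := by
    intro j hj hjl
    rcases Relation.ReflTransGen.cases_head (h.reach l hl j hj hjl.symm) with he | hz
    · exact absurd he (h.ne_neg h3 hl hj)
    · exact hz
  obtain ⟨z, hz, -⟩ := head j₀ hj₀ hjl
  have huniq : ∀ z', Arc φ (p l) z' → z' = z := by
    intro z' hz'
    have := Finset.card_le_one.1 hQ _ (Finset.mem_filter.2 ⟨hz', by simp⟩) _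
      (Finset.mem_filter.2 ⟨hz, by simp⟩)
    exact pair_right_inj.1 this
  have hzr : ∀ j ∈ I, j ≠ l → Reach φ z (negLit (p j)) := by
    intro j hj hjl
    obtain ⟨z', hz', hr⟩ := head j hj hjl
    exact huniq z' hz' ▸ hr
  have hzl : ¬ Reach φ z (p l) := fun hr =>
    hn l hl _ hz (by simp [eq_of_reach hn hl hr])
  have hrest : ∀ a, ¬ Reach φ a (p l) → ∀ j ∈ I, j ≠ l → Reach φ a (negLit (p j)) →
      Reach (φ.erase {negLit (p l), z}) a (negLit (p j)) := by
    intro a ha j hj hjl har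
    refine har.restrict fun v w hv hw hvw => ?_
    refine Arc.reach (Finset.mem_erase.2 ⟨fun he => ?_, hvw⟩)
    have : negLit (p l) ∈ ({negLit v, w} : Clause V) := he ▸ by simp
    simp only [Finset.mem_insert, Finset.mem_singleton, negLit_inj] at this
    rcases this with rfl | rfl
    · exact ha hv
    · exact h.not_reach' hl hj hjl.symm hw
  refine ⟨φ.erase {negLit (p l), z}, Function.update p l z, ⟨?_, ?_, ?_⟩,
    Finset.card_erase_lt_of_mem hz⟩
  · exact fun C hC => h.card_le C (Finset.mem_of_mem_erase hC)
  · intro i hi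
    obtain ⟨α, hα, hp⟩ := h.sat i hi
    refine ⟨α, fun C hC => hα C (Finset.mem_of_mem_erase hC), ?_⟩
    by_cases hil : i = l
    · subst hil; simpa using hz.reach.litSat hα hp
    · simpa [hil] using hp
  · intro i hi j hj hij
    by_cases hil : i = l
    · subst hil
      simpa [hij.symm] using hrest z hzl j hj hij.symm (hzr j hj hij.symm)
    · by_cases hjl : j = l
      · subst hjl
        simpa [hil] using (hrest z hzl i hi hil (hzr i hi hil)).contra'
      · simpa [hil, hjl] using
          hrest (p i) (h.not_reach hi hl hil) j hj hjl (h.reach i hi j hj hij)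

/-- If `negLit y` occurs only in the clause `{negLit y, z}`, then `y` can be replaced by `z`. -/
lemma substitute (h : Enc φ I p) {y z : Lit V} (hy : ∀ i ∈ I, p i ≠ y ∧ p i ≠ negLit y)
    (hC : ({negLit y, z} : Clause V) ∈ φ) (hz : z ≠ negLit y)
    (hocc : ∀ C ∈ φ, negLit y ∈ C → C = {negLit y, z}) :
    ∃ φ' : CNF V, Enc φ' I p ∧ φ'.card < φ.card := by
  let f : Clause V → Clause V := fun D => if y ∈ D then insert z (D.erase y) else D
  let σ : Lit V → Lit V := fun v => if v = y then z else if v = negLit y then negLit z else v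
  have hyy := negLit_ne y
  have hσ : ∀ v, σ (negLit v) = negLit (σ v) := by
    intro v
    simp only [σ]
    by_cases h1 : v = y
    · subst h1; simp [hyy]
    · by_cases h2 : v = negLit y
      · subst h2; simp [hyy]
      · have h3 : negLit v ≠ y := fun e => h2 (negLit_eq_comm.1 e)
        have h4 : negLit v ≠ negLit y := fun e => h1 (negLit_inj.1 e)
        simp [h1, h2, h3, h4]
  have hσf : ∀ D ∈ φ, D ≠ {negLit y, z} → f D = D.image σ := by
    intro D hD hne
    have hnD : negLit y ∉ D := fun hm => hne (hocc D hD hm)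
    have hσid : ∀ v ∈ D.erase y, σ v = v := by
      intro v hv
      obtain ⟨h1, h2⟩ := Finset.mem_erase.1 hv
      have h3 : v ≠ negLit y := by rintro rfl; exact hnD h2
      simp [σ, h1, h3]
    by_cases hyD : y ∈ D
    · have : D.image σ = insert (σ y) ((D.erase y).image σ) := by
        rw [← Finset.image_insert, Finset.insert_erase hyD]
      rw [this, Finset.image_congr (g := id) (fun v hv => hσid v hv), Finset.image_id]
      simp [f, σ, hyD]
    · rw [Finset.erase_eq_of_notMem hyD] at hσid
      rw [Finset.image_congr (g := id) (fun v hv => hσid v hv), Finset.image_id]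
      simp [f, hyD]
  refine ⟨(φ.erase {negLit y, z}).image f, ⟨?_, ?_, ?_⟩,
    Finset.card_image_le.trans_lt (Finset.card_erase_lt_of_mem hC)⟩
  · intro D' hD'
    obtain ⟨D, hD, rfl⟩ := Finset.mem_image.1 hD'
    obtain ⟨hne, hD⟩ := Finset.mem_erase.1 hD
    rw [hσf D hD hne]
    exact Finset.card_image_le.trans (h.card_le D hD)
  · intro i hi
    obtain ⟨α, hα, hp⟩ := h.sat i hi
    refine ⟨α, fun D' hD' => ?_, hp⟩
    obtain ⟨D, hD, rfl⟩ := Finset.mem_image.1 hD'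
    obtain ⟨hne, hD⟩ := Finset.mem_erase.1 hD
    obtain ⟨l, hl, hs⟩ := hα D hD
    by_cases hyD : y ∈ D
    · by_cases hly : l = y
      · refine ⟨z, by simp [f, hyD], ?_⟩
        exact Reach.litSat hα (Arc.reach hC) (hly ▸ hs)
      · exact ⟨l, by simp [f, hyD, hl, hly], hs⟩
    · exact ⟨l, by simpa [f, hyD] using hl, hs⟩
  · intro i hi j hj hij
    have hfix : ∀ i ∈ I, σ (p i) = p i := fun i hi => by simp [σ, (hy i hi).1, (hy i hi).2]
    have : Reach _ (σ (p i)) (σ (negLit (p j))) := Relation.ReflTransGen.lift'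
      (p := Arc ((φ.erase {negLit y, z}).image f)) σ (fun v w hvw => ?_) _ _
      (h.reach i hi j hj hij)
    · rw [hσ, hfix i hi, hfix j hj] at this
      exact this
    · change Reach _ _ _
      have hvw' : ({negLit v, w} : Clause V) ∈ φ := hvw
      by_cases he : ({negLit v, w} : Clause V) = {negLit y, z}
      · have h1 : negLit v ∈ ({negLit y, z} : Clause V) := he ▸ by simp
        have h2 : w ∈ ({negLit y, z} : Clause V) := he ▸ by simp
        have h3 : negLit y ∈ ({negLit v, w} : Clause V) := he ▸ by simp
        have h4 : z ∈ ({negLit v, w} : Clause V) := he ▸ by simp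
        simp only [Finset.mem_insert, Finset.mem_singleton, negLit_inj] at h1 h2 h3 h4
        have : σ v = σ w := by
          rcases h3 with h3 | h3
          · subst h3
            rcases h4 with h4 | h4
            · exact absurd h4 hz
            · subst h4; by_cases hzy : z = y <;> simp [σ, hz, hzy]
          · subst h3
            rcases h4 with h4 | h4
            · have : v = negLit z := by rw [h4]; simp
              subst this
              rw [hσ, hσ]
              congr 1
              by_cases hzy : z = y <;> simp [σ, hz, hzy]
            · exact absurd h4 hz
        rw [this]; exact Reach.refl _
      · refine Arc.reach ?_
        unfold Arc
        rw [← hσ]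
        have := hσf _ hvw' he
        rw [Finset.image_insert, Finset.image_singleton] at this
        rw [← this]
        exact Finset.mem_image_of_mem f (Finset.mem_erase.2 ⟨he, hvw'⟩)

end Enc

/-- No encoding smaller than `φ` loses at most one input per three clauses saved. -/
def Irred (φ : CNF V) (I : Finset ι) : Prop :=
  ∀ (φ' : CNF V) (I' : Finset ι) (p' : ι → Lit V) (d : ℕ), Enc φ' I' p' → φ'.card < φ.card →
    I.card ≤ I'.card + d → φ'.card + 3 * d ≤ φ.card → False

/-- The clauses containing the negation of the input literal `p i`. -/
def inputClauses (φ : CNF V) (p : ι → Lit V) (i : ι) : CNF V :=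
  φ.filter fun C => negLit (p i) ∈ C

/-- The clauses containing no negated input literal. -/
def core (φ : CNF V) (I : Finset ι) (p : ι → Lit V) : CNF V :=
  φ.filter fun C => ∀ i ∈ I, negLit (p i) ∉ C

/-- The literals directly implied by the input literal `p i`. -/
def nbr [Fintype V] (φ : CNF V) (p : ι → Lit V) (i : ι) : Finset (Lit V) :=
  Finset.univ.filter fun g => ({negLit (p i), g} : Clause V) ∈ φ

lemma mem_nbr [Fintype V] {φ : CNF V} {p : ι → Lit V} {i : ι} {g : Lit V} :
    g ∈ nbr φ p i ↔ Arc φ (p i) g := by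
  simp [nbr, Arc]

/-- The core of a regular encoding: the pairs of literals `G i` are mutually exclusive. -/
structure Reg (ψ : CNF V) (I : Finset ι) (G : ι → Finset (Lit V)) : Prop where
  card_le : ∀ C ∈ ψ, C.card ≤ 2
  card_eq : ∀ i ∈ I, (G i).card = 2
  sat : ∀ i ∈ I, ∃ α : V → Bool, CnfSat α ψ ∧ ∀ u ∈ G i, LitSat α u
  excl : ∀ i ∈ I, ∀ j ∈ I, i ≠ j → ∃ u ∈ G i, ∃ v ∈ G j, Reach ψ u (negLit v)

namespace Irred

variable {φ : CNF V} {I : Finset ι} {p : ι → Lit V}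

lemma card_filter_eq (hr : Irred φ I) {P : Clause V → Prop} [DecidablePred P]
    (h : Enc (φ.filter P) I p) : ∀ C ∈ φ, P C := by
  by_contra hc
  push Not at hc
  obtain ⟨C, hC, hP⟩ := hc
  have : (φ.filter P).card < φ.card :=
    Finset.card_lt_card (Finset.filter_ssubset.2 ⟨C, hC, hP⟩)
  exact hr _ _ _ 0 h this (by simp) (by omega)

lemma noPos [DecidableEq ι] (hr : Irred φ I) (h : Enc φ I p) : NoPos φ I p :=
  fun i hi C hC => hr.card_filter_eq h.filter_noPos C hC i hi

lemma isClause (hr : Irred φ I) (h : Enc φ I p) : ∀ C ∈ φ, IsClause C :=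
  hr.card_filter_eq h.filter_isClause

lemma card_inputClauses_add (φ : CNF V) (p : ι → Lit V) (i : ι) :
    (φ.filter fun C => negLit (p i) ∉ C).card + (inputClauses φ p i).card = φ.card := by
  rw [add_comm]
  exact Finset.card_filter_add_card_filter_not _

lemma card_inputClauses [DecidableEq ι] (hr : Irred φ I) (h : Enc φ I p) (h3 : 3 ≤ I.card) {i : ι}
    (hi : i ∈ I) : (inputClauses φ p i).card = 2 := by
  apply le_antisymm
  · by_contra hc
    have := card_inputClauses_add φ p i
    refine hr _ _ _ 1 (h.delete hi) (by omega) ?_ (by omega)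
    rw [Finset.card_erase_of_mem hi]; omega
  · by_contra hc
    obtain ⟨φ', p', h', hlt⟩ := h.contract (hr.noPos h) h3 hi
      (show (inputClauses φ p i).card ≤ 1 by omega)
    exact hr _ _ _ 0 h' hlt (by omega) (by omega)

lemma inputClauses_disjoint [DecidableEq ι] (hr : Irred φ I) (h : Enc φ I p) (h4 : 4 ≤ I.card)
    {i j : ι} (hi : i ∈ I) (hj : j ∈ I) (hij : i ≠ j) {C : Clause V} (hC : C ∈ φ)
    (hiC : negLit (p i) ∈ C) : negLit (p j) ∉ C := by
  intro hjC
  have hQi := hr.card_inputClauses h (by omega) hi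
  have hQj := hr.card_inputClauses h (by omega) hj
  have hcard : (I.erase j).card + 1 = I.card := Finset.card_erase_add_one hj
  have hle : ((φ.filter fun C => negLit (p j) ∉ C).filter fun C => negLit (p i) ∈ C).card ≤ 1 := by
    have : ((φ.filter fun C => negLit (p j) ∉ C).filter fun C => negLit (p i) ∈ C) ⊆
        (inputClauses φ p i).erase C := by
      intro D hD
      simp only [Finset.mem_filter, Finset.mem_erase, inputClauses] at hD ⊢
      refine ⟨?_, hD.1.1, hD.2⟩
      rintro rfl
      exact hD.1.2 hjC
    refine (Finset.card_le_card this).trans ?_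
    rw [Finset.card_erase_of_mem (s := inputClauses φ p i) (Finset.mem_filter.2 ⟨hC, hiC⟩)]
    omega
  obtain ⟨φ', p', h', hlt⟩ := (h.delete hj).contract
    (fun l hl C hC => hr.noPos h l (Finset.mem_of_mem_erase hl) C (Finset.mem_filter.1 hC).1)
    (by omega) (Finset.mem_erase.2 ⟨hij, hi⟩) hle
  have := card_inputClauses_add φ p j
  exact hr _ _ _ 1 h' (by omega) (by omega) (by omega)

lemma card_core_add [DecidableEq ι] (hr : Irred φ I) (h : Enc φ I p) (h4 : 4 ≤ I.card) :
    (core φ I p).card + 2 * I.card ≤ φ.card := by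
  have h1 : (I.biUnion (inputClauses φ p)).card = 2 * I.card := by
    rw [Finset.card_biUnion, Finset.sum_congr rfl
      fun i hi => hr.card_inputClauses h (by omega) hi]
    · simp [mul_comm]
    · intro i hi j hj hij
      rw [Function.onFun, Finset.disjoint_left]
      intro C hC hC'
      simp only [inputClauses, Finset.mem_filter] at hC hC'
      exact hr.inputClauses_disjoint h h4 hi hj hij hC.1 hC.2 hC'.2
  rw [← h1, ← Finset.card_union_of_disjoint]
  · refine Finset.card_le_card (Finset.union_subset (Finset.filter_subset _ _) ?_)
    exact Finset.biUnion_subset.2 fun i _ => Finset.filter_subset _ _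
  · rw [Finset.disjoint_left]
    intro C hC hC'
    obtain ⟨i, hi, hiC⟩ := Finset.mem_biUnion.1 hC'
    exact (Finset.mem_filter.1 hC).2 i hi (Finset.mem_filter.1 hiC).2

lemma inputClauses_eq_image [Fintype V] (h : Enc φ I p) (i : ι) :
    inputClauses φ p i = (nbr φ p i).image fun g => {negLit (p i), g} := by
  ext C
  simp only [inputClauses, Finset.mem_filter, Finset.mem_image, mem_nbr, Arc]
  constructor
  · rintro ⟨hC, hi⟩
    obtain ⟨b, rfl⟩ := clause_eq_pair (h.card_le C hC) hi
    exact ⟨b, hC, rfl⟩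
  · rintro ⟨g, hg, rfl⟩
    exact ⟨hg, by simp⟩

section Regular

variable [DecidableEq ι] [Fintype V]

lemma ne_of_mem_nbr (hr : Irred φ I) (h : Enc φ I p) (h4 : 4 ≤ I.card) {i j : ι} (hi : i ∈ I)
    (hj : j ∈ I) {g : Lit V} (hg : g ∈ nbr φ p i) : g ≠ p j ∧ g ≠ negLit (p j) := by
  rw [mem_nbr] at hg
  refine ⟨fun he => hr.noPos h j hj _ hg (by simp [he]), fun he => ?_⟩
  by_cases hij : i = j
  · subst hij
    exact h.not_reach_neg hi (Reach.refl _) (he ▸ hg.reach)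
  · exact hr.inputClauses_disjoint h h4 hi hj hij hg (by simp) (by simp [he])

lemma reg (hr : Irred φ I) (h : Enc φ I p) (h4 : 4 ≤ I.card) :
    Reg (core φ I p) I (nbr φ p) := by
  refine ⟨fun C hC => h.card_le C (Finset.mem_filter.1 hC).1, fun i hi => ?_, fun i hi => ?_,
    fun i hi j hj hij => ?_⟩
  · rw [← hr.card_inputClauses h (by omega) hi, inputClauses_eq_image h,
      Finset.card_image_of_injective _ fun a b hab => pair_right_inj.1 hab]
  · obtain ⟨α, hα, hp⟩ := h.sat i hi
    exact ⟨α, fun C hC => hα C (Finset.mem_filter.1 hC).1,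
      fun u hu => (mem_nbr.1 hu).reach.litSat hα hp⟩
  · rcases Relation.ReflTransGen.cases_head (h.reach i hi j hj hij) with he | ⟨u, hu, hr1⟩
    · exact absurd he (h.ne_neg (by omega) hi hj)
    have hu' := mem_nbr.2 hu
    rcases Relation.ReflTransGen.cases_tail hr1 with he | ⟨w, hr2, hw⟩
    · exact absurd he.symm (hr.ne_of_mem_nbr h h4 hi hj hu').2
    have hw' : negLit w ∈ nbr φ p j := by
      rw [mem_nbr]; simpa using hw.contra
    refine ⟨u, hu', negLit w, hw', ?_⟩
    rw [negLit_negLit]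
    refine Reach.restrict hr2 fun a b ha hb hab => ?_
    refine Arc.reach (Finset.mem_filter.2 ⟨hab, fun l hl => ?_⟩)
    simp only [Finset.mem_insert, Finset.mem_singleton, negLit_inj]
    rintro (rfl | rfl)
    · exact (hr.ne_of_mem_nbr h h4 hi hl hu').1 (Enc.eq_of_reach (hr.noPos h) hl ha)
    · refine (hr.ne_of_mem_nbr h h4 hj hl hw').1 ?_
      rw [Enc.eq_of_reach' (hr.noPos h) hl hb, negLit_negLit]

end Regular

end Irred

section Degree

variable [Fintype V] {φ : CNF V} {I : Finset ι} {p : ι → Lit V}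

/-- The inputs of which `w` is a neighbour. -/
def users (I : Finset ι) (G : ι → Finset (Lit V)) (w : Lit V) : Finset ι :=
  I.filter fun i => w ∈ G i

lemma mem_core_or (h : Enc φ I p) {y : Lit V} (hy : ∀ i ∈ I, p i ≠ negLit y) {C : Clause V}
    (hC : C ∈ φ) (hyC : y ∈ C) :
    C ∈ core φ I p ∨ ∃ j ∈ users I (nbr φ p) y, negLit (p j) ∈ C := by
  by_cases hc : C ∈ core φ I p
  · exact Or.inl hc
  right
  simp only [core, Finset.mem_filter, not_and] at hc
  have := hc hC
  push Not at this
  obtain ⟨j, hj, hjC⟩ := this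
  obtain ⟨b, rfl⟩ := clause_eq_pair (h.card_le C hC) hjC
  refine ⟨j, Finset.mem_filter.2 ⟨hj, mem_nbr.2 ?_⟩, hjC⟩
  simp only [Finset.mem_insert, Finset.mem_singleton] at hyC
  rcases hyC with rfl | rfl
  · exact absurd (negLit_negLit _).symm (hy j hj)
  · exact hC

variable [DecidableEq ι]

namespace Irred

lemma users_lt (hr : Irred φ I) (h : Enc φ I p) (h4 : 4 ≤ I.card) {y : Lit V}
    (hy : ∀ i ∈ I, p i ≠ y ∧ p i ≠ negLit y) (hocc : ∀ C ∈ core φ I p, negLit y ∉ C)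
    (hpos : 1 ≤ (users I (nbr φ p) y).card + ((core φ I p).filter (y ∈ ·)).card) :
    (users I (nbr φ p) y).card + ((core φ I p).filter (y ∈ ·)).card <
      (users I (nbr φ p) (negLit y)).card := by
  set A := users I (nbr φ p) y with hA
  set B := users I (nbr φ p) (negLit y) with hB
  set P := (core φ I p).filter (y ∈ ·) with hP
  have hAI : A ⊆ I := Finset.filter_subset _ _
  have hBI : B ⊆ I := Finset.filter_subset _ _
  have hd := h.delete_deadEnd hBI hy fun C hC hyC => by
    rcases mem_core_or h (fun i hi => by simpa using (hy i hi).1) hC hyC with hc | hc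
    · exact absurd hyC (hocc C hc)
    · exact hc
  set φ' := φ.filter fun C => y ∉ C ∧ ∀ j ∈ B, negLit (p j) ∉ C
  have hp : ∀ i ∈ I, ∀ j ∈ I, p i = p j → i = j := by
    intro i hi j hj he
    by_contra hij
    exact h.not_reach hi hj hij (he ▸ Reach.refl _)
  have c1 : (B.biUnion (inputClauses φ p)).card = 2 * B.card := by
    rw [Finset.card_biUnion, Finset.sum_congr rfl
      fun i hi => hr.card_inputClauses h (by omega) (hBI hi)]
    · simp [mul_comm]
    · intro i hi j hj hij
      rw [Function.onFun, Finset.disjoint_left]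
      intro C hC hC'
      simp only [inputClauses, Finset.mem_filter] at hC hC'
      exact hr.inputClauses_disjoint h h4 (hBI hi) (hBI hj) hij hC.1 hC.2 hC'.2
  have c2 : (A.image fun i => ({negLit (p i), y} : Clause V)).card = A.card := by
    apply Finset.card_image_of_injOn
    intro i hi j hj hij
    simp only [Finset.pair_comm _ y, pair_right_inj, negLit_inj] at hij
    exact hp i (hAI hi) j (hAI hj) hij
  have hAm : ∀ i ∈ A, ({negLit (p i), y} : Clause V) ∈ φ := fun i hi =>
    mem_nbr.1 (Finset.mem_filter.1 hi).2
  have d1 : Disjoint (B.biUnion (inputClauses φ p))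
      (A.image fun i => ({negLit (p i), y} : Clause V)) := by
    rw [Finset.disjoint_left]
    intro C hC hC'
    obtain ⟨j, hj, hjC⟩ := Finset.mem_biUnion.1 hC
    obtain ⟨i, hi, rfl⟩ := Finset.mem_image.1 hC'
    have := (Finset.mem_filter.1 hjC).2
    simp only [Finset.mem_insert, Finset.mem_singleton, negLit_inj] at this
    rcases this with he | he
    · obtain rfl := hp j (hBI hj) i (hAI hi) he
      exact h.not_reach_neg (hBI hj) (mem_nbr.1 (Finset.mem_filter.1 hi).2).reach
        (mem_nbr.1 (Finset.mem_filter.1 hj).2).reach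
    · exact (hy j (hBI hj)).2 (negLit_eq_comm.1 he)
  have d2 : Disjoint (B.biUnion (inputClauses φ p) ∪
      A.image fun i => ({negLit (p i), y} : Clause V)) P := by
    rw [Finset.disjoint_left]
    intro C hC hC'
    have hcore := (Finset.mem_filter.1 (Finset.mem_filter.1 hC').1).2
    rcases Finset.mem_union.1 hC with hC | hC
    · obtain ⟨j, hj, hjC⟩ := Finset.mem_biUnion.1 hC
      exact hcore j (hBI hj) (Finset.mem_filter.1 hjC).2
    · obtain ⟨i, hi, rfl⟩ := Finset.mem_image.1 hC
      exact hcore i (hAI hi) (by simp)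
  set R := B.biUnion (inputClauses φ p) ∪
      (A.image fun i => ({negLit (p i), y} : Clause V)) ∪ P with hR
  have hRc : R.card = 2 * B.card + A.card + P.card := by
    rw [hR, Finset.card_union_of_disjoint d2, Finset.card_union_of_disjoint d1, c1, c2]
  have hle : φ'.card + R.card ≤ φ.card := by
    rw [← Finset.card_union_of_disjoint]
    · refine Finset.card_le_card (Finset.union_subset (Finset.filter_subset _ _) ?_)
      refine Finset.union_subset (Finset.union_subset ?_ ?_)
        ((Finset.filter_subset _ _).trans (Finset.filter_subset _ _))
      · exact Finset.biUnion_subset.2 fun i _ => Finset.filter_subset _ _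
      · exact Finset.image_subset_iff.2 hAm
    · rw [Finset.disjoint_left]
      intro C hC hC'
      obtain ⟨-, hyC, hBC⟩ := Finset.mem_filter.1 hC
      rcases Finset.mem_union.1 hC' with hC' | hC'
      · rcases Finset.mem_union.1 hC' with hC' | hC'
        · obtain ⟨j, hj, hjC⟩ := Finset.mem_biUnion.1 hC'
          exact hBC j hj (Finset.mem_filter.1 hjC).2
        · obtain ⟨i, hi, rfl⟩ := Finset.mem_image.1 hC'
          exact hyC (by simp)
      · exact hyC (Finset.mem_filter.1 hC').2
  by_contra hlt
  have := Finset.card_sdiff_add_card_eq_card hBI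
  exact hr _ _ _ B.card hd (by omega) (by omega) (by omega)

lemma not_unique_core_clause (hr : Irred φ I) (h : Enc φ I p) (h4 : 4 ≤ I.card) {y : Lit V}
    (hy : ∀ i ∈ I, p i ≠ y ∧ p i ≠ negLit y) (hdeg : (users I (nbr φ p) y).card ≤ 3)
    {C : Clause V} (hC : C ∈ core φ I p) (hyC : negLit y ∈ C)
    (huniq : ∀ D ∈ core φ I p, (y ∈ D ∨ negLit y ∈ D) → D = C) : False := by
  have hCφ : C ∈ φ := (Finset.mem_filter.1 hC).1
  have hynC : y ∉ C := fun hc => hr.isClause h C hCφ y hc hyC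
  have hP : 1 ≤ ((core φ I p).filter (negLit y ∈ ·)).card :=
    Finset.card_pos.2 ⟨C, Finset.mem_filter.2 ⟨hC, hyC⟩⟩
  have hlt := hr.users_lt h h4 (y := negLit y)
    (fun i hi => ⟨(hy i hi).2, by simpa using (hy i hi).1⟩)
    (fun D hD hyD => by
      rw [negLit_negLit] at hyD
      exact hynC (huniq D hD (Or.inl hyD) ▸ hyD)) (by omega)
  rw [negLit_negLit] at hlt
  obtain ⟨z, rfl⟩ := clause_eq_pair (h.card_le C hCφ) hyC
  have hz : z ≠ negLit y := by
    rintro rfl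
    obtain ⟨i, hi⟩ : (users I (nbr φ p) y).Nonempty := Finset.card_pos.1 (by omega)
    obtain ⟨hi, hiy⟩ := Finset.mem_filter.1 hi
    have hr1 : Reach φ (p i) y := (mem_nbr.1 hiy).reach
    exact h.not_reach_neg hi hr1 (hr1.trans (Arc.reach hCφ))
  have hor : ∀ D ∈ φ, negLit y ∈ D → D = {negLit y, z} ∨
      ∃ j ∈ users I (nbr φ p) (negLit y), negLit (p j) ∈ D := by
    intro D hD hyD
    rcases mem_core_or h (fun i hi => by simpa using (hy i hi).1) hD hyD with hc | hc
    · exact Or.inl (huniq D hc (Or.inr hyD))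
    · exact Or.inr hc
  rcases Nat.lt_or_ge (users I (nbr φ p) (negLit y)).card 1 with hb | hb
  · obtain ⟨φ', h', hlt'⟩ := h.substitute hy hCφ hz fun D hD hyD => by
      rcases hor D hD hyD with hc | ⟨j, hj, -⟩
      · exact hc
      · rw [Finset.card_eq_zero.1 (Nat.lt_one_iff.1 hb)] at hj
        simp at hj
    exact hr _ _ _ 0 h' hlt' (by omega) (by omega)
  · obtain ⟨j, hj⟩ := Finset.card_eq_one.1 (show (users I (nbr φ p) (negLit y)).card = 1 by omega)
    have hjI : j ∈ I := (Finset.mem_filter.1 (hj ▸ Finset.mem_singleton_self j :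
      j ∈ users I (nbr φ p) (negLit y))).1
    obtain ⟨φ', h', hlt'⟩ := (h.delete hjI).substitute (y := y) (z := z)
      (fun i hi => hy i (Finset.mem_of_mem_erase hi))
      (Finset.mem_filter.2 ⟨hCφ, (Finset.mem_filter.1 hC).2 j hjI⟩) hz fun D hD hyD => by
        obtain ⟨hD, hjD⟩ := Finset.mem_filter.1 hD
        rcases hor D hD hyD with hc | ⟨j', hj', hj'D⟩
        · exact hc
        · rw [hj, Finset.mem_singleton] at hj'
          subst hj'
          exact absurd hj'D hjD
    have h1 := card_inputClauses_add φ p j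
    have h2 := hr.card_inputClauses h (by omega) hjI
    have h3 := Finset.card_erase_add_one hjI
    exact hr _ _ _ 1 h' (by omega) (by omega) (by omega)

lemma two_le_touching (hr : Irred φ I) (h : Enc φ I p) (h4 : 4 ≤ I.card)
    (hdeg : ∀ y, (users I (nbr φ p) y).card ≤ 3) {i : ι} (hi : i ∈ I) {y : Lit V}
    (hiy : y ∈ nbr φ p i) :
    2 ≤ ((core φ I p).filter fun C => y ∈ C ∨ negLit y ∈ C).card := by
  have hy : ∀ j ∈ I, p j ≠ y ∧ p j ≠ negLit y := fun j hj => by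
    obtain ⟨h1, h2⟩ := hr.ne_of_mem_nbr h h4 hi hj hiy
    exact ⟨h1.symm, fun he => h2 (negLit_eq_comm.1 he.symm)⟩
  have hy' : ∀ j ∈ I, p j ≠ negLit y ∧ p j ≠ negLit (negLit y) := fun j hj =>
    ⟨(hy j hj).2, by simpa using (hy j hj).1⟩
  by_contra hc
  rcases Nat.lt_or_ge ((core φ I p).filter fun C => y ∈ C ∨ negLit y ∈ C).card 1 with h0 | h1
  · have hno : ∀ C ∈ core φ I p, ¬ (y ∈ C ∨ negLit y ∈ C) :=
      Finset.filter_eq_empty_iff.1 (Finset.card_eq_zero.1 (by omega))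
    have hpos : 0 < (users I (nbr φ p) y).card :=
      Finset.card_pos.2 ⟨i, Finset.mem_filter.2 ⟨hi, hiy⟩⟩
    have l1 := hr.users_lt h h4 hy (fun C hC hyC => hno C hC (Or.inr hyC)) (by omega)
    have l2 := hr.users_lt h h4 hy'
      (fun C hC hyC => hno C hC (Or.inl (by simpa using hyC))) (by omega)
    rw [negLit_negLit] at l2
    omega
  · obtain ⟨C, hC⟩ := Finset.card_eq_one.1 (show _ = 1 by exact le_antisymm (by omega) h1)
    have hCm : C ∈ core φ I p ∧ (y ∈ C ∨ negLit y ∈ C) :=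
      Finset.mem_filter.1 (hC ▸ Finset.mem_singleton_self C)
    have huniq : ∀ D ∈ core φ I p, (y ∈ D ∨ negLit y ∈ D) → D = C := fun D hD hyD =>
      Finset.mem_singleton.1 (hC ▸ Finset.mem_filter.2 ⟨hD, hyD⟩)
    rcases hCm.2 with hyC | hyC
    · refine hr.not_unique_core_clause h h4 hy' (hdeg _) hCm.1 (by simpa using hyC) ?_
      intro D hD hyD
      rw [negLit_negLit] at hyD
      exact huniq D hD hyD.symm
    · exact hr.not_unique_core_clause h h4 hy (hdeg _) hCm.1 hyC huniq

lemma card_le_three_mul_core (hr : Irred φ I) (h : Enc φ I p) (h4 : 4 ≤ I.card)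
    (hdeg : ∀ y, (users I (nbr φ p) y).card ≤ 3) : I.card ≤ 3 * (core φ I p).card := by
  set W := (I.biUnion (nbr φ p)).image Prod.fst with hW
  have e1 := Finset.sum_card_bipartiteAbove_eq_sum_card_bipartiteBelow (s := I)
    (t := W ×ˢ (Finset.univ : Finset Bool)) (fun i w => w ∈ nbr φ p i)
  have e2 := Finset.sum_card_bipartiteAbove_eq_sum_card_bipartiteBelow (s := core φ I p)
    (t := W) (fun C v => (v, true) ∈ C ∨ (v, false) ∈ C)
  have b1 : I.card * 2 ≤ ∑ i ∈ I, ((W ×ˢ (Finset.univ : Finset Bool)).bipartiteAbove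
      (fun i w => w ∈ nbr φ p i) i).card := by
    rw [← smul_eq_mul]
    refine Finset.card_nsmul_le_sum _ _ _ fun i hi => ?_
    rw [← (hr.reg h h4).card_eq i hi]
    refine Finset.card_le_card fun w hw => Finset.mem_filter.2 ⟨?_, hw⟩
    rw [Finset.mem_product]
    exact ⟨Finset.mem_image_of_mem _ (Finset.mem_biUnion.2 ⟨i, hi, hw⟩), Finset.mem_univ _⟩
  have b2 : ∑ w ∈ W ×ˢ (Finset.univ : Finset Bool), (I.bipartiteBelow
      (fun i w => w ∈ nbr φ p i) w).card ≤ (W ×ˢ (Finset.univ : Finset Bool)).card * 3 :=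
    Finset.sum_le_card_nsmul _ _ _ fun w _ => hdeg w
  have b3 : ∑ C ∈ core φ I p, (W.bipartiteAbove
      (fun C v => (v, true) ∈ C ∨ (v, false) ∈ C) C).card ≤ (core φ I p).card * 2 := by
    refine Finset.sum_le_card_nsmul _ _ _ fun C hC => ?_
    refine le_trans (Finset.card_le_card (t := C.image Prod.fst) fun v hv => ?_)
      (Finset.card_image_le.trans ((hr.reg h h4).card_le C hC))
    rcases (Finset.mem_filter.1 hv).2 with hv | hv
    · exact Finset.mem_image_of_mem Prod.fst hv
    · exact Finset.mem_image_of_mem Prod.fst hv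
  have b4 : W.card * 2 ≤ ∑ v ∈ W, ((core φ I p).bipartiteBelow
      (fun C v => (v, true) ∈ C ∨ (v, false) ∈ C) v).card := by
    rw [← smul_eq_mul]
    refine Finset.card_nsmul_le_sum _ _ _ fun v hv => ?_
    obtain ⟨⟨v', s⟩, hy, rfl⟩ := Finset.mem_image.1 hv
    obtain ⟨i, hi, hiy⟩ := Finset.mem_biUnion.1 hy
    refine (hr.two_le_touching h h4 hdeg hi hiy).trans (Finset.card_le_card fun C hC => ?_)
    obtain ⟨hC, hyC⟩ := Finset.mem_filter.1 hC
    refine Finset.mem_filter.2 ⟨hC, ?_⟩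
    cases s <;> simpa [negLit, or_comm] using hyC
  have c1 := b1.trans (e1.le.trans b2)
  have c2 := b4.trans (e2.symm.le.trans b3)
  rw [Finset.card_product, Finset.card_univ, Fintype.card_bool] at c1
  omega

end Irred

end Degree

lemma pigeonhole_bound {n k b t E : ℤ} (hk : 4 ≤ k) (hb1 : 1 ≤ b) (hbk : b ≤ k)
    (hn : n ≤ 1 + k * (t - (k - 1)) + b * (k - 1)) (ht : k + b - 2 ≤ t)
    (hE : k - 1 + 2 * t ≤ 2 * E + 4) (hE' : 3 ≤ b → k + b - 2 + 2 * t ≤ 2 * E + 4) :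
    4 * n ≤ (E + 3) ^ 2 := by
  obtain ⟨s, rfl⟩ : ∃ s, t = s + k := ⟨t - k, by ring⟩
  have key : (b ≠ 2 ∨ k = 4) → k + b - 2 + 2 * (s + k) ≤ 2 * E + 4 := by
    intro h
    rcases lt_or_ge b 3 with h3 | h3
    · omega
    · exact hE' h3
  by_cases hc : b ≠ 2 ∨ k = 4
  · have h1 := key hc
    obtain ⟨δ, rfl⟩ : ∃ δ, b = k - δ := ⟨k - b, by ring⟩
    have h2 : (2 * s + 4 * k - δ) ^ 2 ≤ (2 * (E + 3)) ^ 2 :=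
      pow_le_pow_left₀ (by linarith) (by linarith) 2
    have h3 : 0 ≤ (2 * s - δ) ^ 2 + 8 * (δ * (k - 2)) - 16 := by
      rcases eq_or_lt_of_le (show 0 ≤ δ by linarith) with h0 | h0
      · subst h0
        nlinarith [show 2 ≤ s by linarith]
      · nlinarith [sq_nonneg (2 * s - δ)]
    nlinarith
  · push Not at hc
    obtain ⟨rfl, hk4⟩ := hc
    have hk5 : 5 ≤ k := by omega
    have h2 : (2 * s + 3 * k + 1) ^ 2 ≤ (2 * (E + 3)) ^ 2 :=
      pow_le_pow_left₀ (by linarith) (by linarith) 2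
    nlinarith [sq_nonneg (2 * s - (k - 1))]

namespace Reg

variable {ψ : CNF V} {I : Finset ι} {G : ι → Finset (Lit V)}

lemma exists_other (hg : Reg ψ I G) {i : ι} (hi : i ∈ I) {w : Lit V} (hw : w ∈ G i) :
    ∃ u, u ≠ w ∧ G i = {w, u} := by
  have h1 : ((G i).erase w).card = 1 := by rw [Finset.card_erase_of_mem hw, hg.card_eq i hi]
  obtain ⟨u, hu⟩ := Finset.card_eq_one.1 h1
  refine ⟨u, ?_, by rw [← hu, Finset.insert_erase hw]⟩
  exact (Finset.mem_erase.1 (hu ▸ Finset.mem_singleton_self u : u ∈ (G i).erase w)).1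

lemma not_reach_neg (hg : Reg ψ I G) {i : ι} (hi : i ∈ I) {u v a : Lit V} (hu : u ∈ G i)
    (hv : v ∈ G i) (h1 : Reach ψ u a) (h2 : Reach ψ v (negLit a)) : False := by
  obtain ⟨α, hα, hs⟩ := hg.sat i hi
  exact not_litSat_negLit (h1.litSat hα (hs u hu)) (h2.litSat hα (hs v hv))

lemma reach_other (hg : Reg ψ I G) {i j : ι} (hi : i ∈ I) (hj : j ∈ I) (hij : i ≠ j)
    {w u v : Lit V} (hGi : G i = {w, u}) (hGj : G j = {w, v}) : Reach ψ u (negLit v) := by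
  obtain ⟨u', hu', v', hv', hr⟩ := hg.excl i hi j hj hij
  rcases (by simpa [hGi] using hu' : u' = w ∨ u' = u) with rfl | rfl
  · exact (hg.not_reach_neg hj hv' (by simp [hGj]) (Reach.refl _) hr).elim
  · rcases (by simpa [hGj] using hv' : v' = w ∨ v' = v) with rfl | rfl
    · exact (hg.not_reach_neg hi (by simp [hGi]) hu' (Reach.refl _) hr).elim
    · exact hr

/-- `o i` is the partner of `h` in `G i` for all `i` in the star of `h`. -/
def IsStar (I : Finset ι) (G : ι → Finset (Lit V)) (h : Lit V) (o : ι → Lit V) : Prop :=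
  ∀ i ∈ users I G h, o i ≠ h ∧ G i = {h, o i}

lemma exists_isStar (hg : Reg ψ I G) (h : Lit V) : ∃ o, IsStar I G h o := by
  have : ∀ i, ∃ u, i ∈ users I G h → u ≠ h ∧ G i = {h, u} := by
    intro i
    by_cases hi : i ∈ users I G h
    · obtain ⟨hi, hh⟩ := Finset.mem_filter.1 hi
      obtain ⟨u, hu⟩ := hg.exists_other hi hh
      exact ⟨u, fun _ => hu⟩
    · exact ⟨h, fun hi' => absurd hi' hi⟩
  choose o ho using this
  exact ⟨o, ho⟩

section Star

variable {h : Lit V} {o : ι → Lit V}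

lemma star_reach (hg : Reg ψ I G) (ho : IsStar I G h o) {i j : ι} (hi : i ∈ users I G h)
    (hj : j ∈ users I G h) (hij : i ≠ j) : Reach ψ (o i) (negLit (o j)) :=
  hg.reach_other (Finset.mem_filter.1 hi).1 (Finset.mem_filter.1 hj).1 hij (ho i hi).2 (ho j hj).2

lemma star_not_reach_neg (hg : Reg ψ I G) (ho : IsStar I G h o) {i : ι} (hi : i ∈ users I G h)
    {a : Lit V} (h1 : Reach ψ (o i) a) (h2 : Reach ψ (o i) (negLit a)) : False := by
  have : o i ∈ G i := by rw [(ho i hi).2]; simp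
  exact hg.not_reach_neg (Finset.mem_filter.1 hi).1 this this h1 h2

lemma star_injOn (hg : Reg ψ I G) (ho : IsStar I G h o) :
    Set.InjOn o (users I G h : Set ι) := by
  intro i hi j hj he
  by_contra hij
  have := hg.star_reach ho (Finset.mem_coe.1 hi) (Finset.mem_coe.1 hj) hij
  rw [← he] at this
  exact hg.star_not_reach_neg ho (Finset.mem_coe.1 hi) (Reach.refl _) this

lemma star_ne_neg (hg : Reg ψ I G) (ho : IsStar I G h o) {l m : ι} (hl : l ∈ users I G h)
    (hm : m ∈ users I G h) (hlm : m ≠ l) {a : Lit V} (ha : Reach ψ a (negLit (o m))) :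
    a ≠ negLit (o l) := by
  rintro rfl
  exact hg.star_not_reach_neg ho hm (Reach.contra' ha |>.trans (by simpa using Reach.refl _))
    (hg.star_reach ho hm hl hlm)

variable [DecidableEq ι]

lemma exists_third {U : Finset ι} (hU : 3 ≤ U.card) (i j : ι) : ∃ m ∈ U, m ≠ i ∧ m ≠ j := by
  obtain ⟨m, hm, hmn⟩ : ∃ m ∈ U, m ∉ ({i, j} : Finset ι) :=
    Finset.exists_mem_notMem_of_card_lt_card (lt_of_le_of_lt Finset.card_le_two hU)
  simp only [Finset.mem_insert, Finset.mem_singleton, not_or] at hmn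
  exact ⟨m, hm, hmn⟩

/-- The implications from `o i` to the negations of the other partners branch somewhere. -/
lemma exists_branching (hg : Reg ψ I G) (ho : IsStar I G h o) (hU : 3 ≤ (users I G h).card)
    {i : ι} (hi : i ∈ users I G h) :
    ∃ c, Reach ψ (o i) c ∧ (∀ l ∈ users I G h, l ≠ i → Reach ψ c (negLit (o l))) ∧
      2 ≤ (ψ.filter (negLit c ∈ ·)).card := by
  obtain ⟨l₀, hl₀, hl₀i, -⟩ := exists_third hU i i
  have key : ∀ a, Reach ψ a (negLit (o l₀)) → Reach ψ (o i) a →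
      (∀ l ∈ users I G h, l ≠ i → Reach ψ a (negLit (o l))) →
      ∃ c, Reach ψ (o i) c ∧ (∀ l ∈ users I G h, l ≠ i → Reach ψ c (negLit (o l))) ∧
        2 ≤ (ψ.filter (negLit c ∈ ·)).card := by
    intro a ha
    induction ha using Relation.ReflTransGen.head_induction_on with
    | refl =>
      intro _ hall
      obtain ⟨m, hm, hmi, hml⟩ := exists_third hU i l₀
      exact absurd rfl (hg.star_ne_neg ho hl₀ hm hml (hall m hm hmi))
    | @head a z haz hz ih =>
      intro hia hall
      by_cases h2 : 2 ≤ (ψ.filter (negLit a ∈ ·)).card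
      · exact ⟨a, hia, hall, h2⟩
      refine ih (hia.trans haz.reach) fun l hl hli => ?_
      obtain ⟨m, hm, hmi, hml⟩ := exists_third hU i l
      rcases Relation.ReflTransGen.cases_head (hall l hl hli) with he | ⟨z', hz', hr⟩
      · exact absurd he (hg.star_ne_neg ho hl hm hml (hall m hm hmi))
      · have := Finset.card_le_one.1
          (show (ψ.filter (negLit a ∈ ·)).card ≤ 1 by omega) _
          (Finset.mem_filter.2 ⟨hz', Finset.mem_insert_self _ _⟩) _
          (Finset.mem_filter.2 ⟨haz, Finset.mem_insert_self _ _⟩)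
        rwa [pair_right_inj.1 this] at hr
  exact key (o i) (hg.star_reach ho hi hl₀ hl₀i.symm) (Reach.refl _)
    fun l hl hli => hg.star_reach ho hi hl hli.symm

lemma exists_branching_fun (hg : Reg ψ I G) (ho : IsStar I G h o) (hU : 3 ≤ (users I G h).card)
    {i₁ : ι} (hi₁ : i₁ ∈ users I G h) :
    ∃ c : ι → Lit V, Set.InjOn c ((users I G h).erase i₁ : Finset ι) ∧
      ∀ i ∈ (users I G h).erase i₁, Reach ψ (o i) (c i) ∧ Reach ψ (o i₁) (negLit (c i)) ∧
        negLit (c i) ≠ h ∧ negLit (c i) ≠ o i₁ ∧ 2 ≤ (ψ.filter (negLit (c i) ∈ ·)).card := by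
  have : Nonempty (Lit V) := ⟨h⟩
  choose! c hc using fun i hi => hg.exists_branching ho hU (i := i) hi
  refine ⟨c, fun i hi j hj he => ?_, fun i hi => ?_⟩
  · have hi := Finset.mem_of_mem_erase hi
    have hj := Finset.mem_of_mem_erase hj
    by_contra hij
    exact hg.star_not_reach_neg ho hj (Reach.refl _)
      ((hc j hj).1.trans (he ▸ (hc i hi).2.1 j hj (Ne.symm hij)))
  · obtain ⟨hii, hi⟩ := Finset.mem_erase.1 hi
    obtain ⟨h1, h2, h3⟩ := hc i hi
    refine ⟨h1, (h2 i₁ hi₁ hii.symm).contra', fun he => ?_, fun he => ?_, h3⟩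
    · have hG := (ho i hi).2
      have hh : h ∈ G i := by simp [hG]
      have hoi : o i ∈ G i := by simp [hG]
      exact hg.not_reach_neg (Finset.mem_filter.1 hi).1 hoi hh h1 (he ▸ Reach.refl _)
    · obtain ⟨m, hm, hmi, hm1⟩ := exists_third hU i i₁
      exact hg.star_ne_neg ho hi₁ hm hm1 (h2 m hm hmi) (negLit_eq_comm.1 he)

end Star

/-- Every literal of `T` other than `h` and `g` has a parent clause, and branching literals of `T`
occur in additional clauses. -/
lemma card_add_two_mul_card_le (hg : Reg ψ I G) {α : V → Bool} (hα : CnfSat α ψ) {h g : Lit V}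
    (hh : LitSat α h) (hgs : LitSat α g) {T D : Finset (Lit V)}
    (hT : ∀ w, w ∈ T ↔ Reach ψ h w ∨ Reach ψ g w) (hDT : D ⊆ T)
    (hD : ∀ d ∈ D, d ≠ h ∧ d ≠ g ∧ 2 ≤ (ψ.filter (d ∈ ·)).card) :
    D.card + 2 * T.card ≤ 2 * ψ.card + 4 := by
  have hTs : ∀ w ∈ T, LitSat α w := by
    intro w hw
    rcases (hT w).1 hw with hw | hw
    · exact hw.litSat hα hh
    · exact hw.litSat hα hgs
  set T' := T \ {h, g} with hT'
  have hpar : ∀ w ∈ T', ∃ C ∈ ψ, w ∈ C ∧ ∀ l ∈ T, l ∈ C → l = w := by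
    intro w hw
    obtain ⟨hw, hne⟩ := Finset.mem_sdiff.1 hw
    simp only [Finset.mem_insert, Finset.mem_singleton, not_or] at hne
    obtain ⟨v, hv, hvw⟩ : ∃ v ∈ T, Arc ψ v w := by
      rcases (hT w).1 hw with hr | hr
      · rcases Relation.ReflTransGen.cases_tail hr with he | ⟨v, hv, hvw⟩
        · exact absurd he hne.1
        · exact ⟨v, (hT v).2 (Or.inl hv), hvw⟩
      · rcases Relation.ReflTransGen.cases_tail hr with he | ⟨v, hv, hvw⟩
        · exact absurd he hne.2
        · exact ⟨v, (hT v).2 (Or.inr hv), hvw⟩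
    refine ⟨_, hvw, by simp, fun l hl hlC => ?_⟩
    simp only [Finset.mem_insert, Finset.mem_singleton] at hlC
    rcases hlC with rfl | rfl
    · exact absurd (hTs _ hl) (not_litSat_negLit (hTs v hv))
    · rfl
  choose! par hparψ hmem huniq using hpar
  have hinj : Set.InjOn par (T' : Set (Lit V)) := by
    intro v hv w hw he
    refine huniq w hw v (Finset.mem_sdiff.1 hv).1 ?_
    rw [← he]
    exact hmem v hv
  have hPψ : T'.image par ⊆ ψ := Finset.image_subset_iff.2 hparψ
  have hPc : (T'.image par).card = T'.card := Finset.card_image_of_injOn hinj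
  have hX : D ⊆ (ψ \ T'.image par).biUnion id := by
    intro d hd
    obtain ⟨h1, h2, h3⟩ := hD d hd
    have hdT : d ∈ T' := Finset.mem_sdiff.2 ⟨hDT hd, by simp [h1, h2]⟩
    obtain ⟨e, he, hne⟩ := Finset.exists_mem_ne (show 1 < (ψ.filter (d ∈ ·)).card by omega) (par d)
    obtain ⟨he, hde⟩ := Finset.mem_filter.1 he
    refine Finset.mem_biUnion.2 ⟨e, Finset.mem_sdiff.2 ⟨he, fun hP => ?_⟩, hde⟩
    obtain ⟨w, hw, rfl⟩ := Finset.mem_image.1 hP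
    exact hne (by rw [huniq w hw d (hDT hd) hde])
  have hXc : D.card ≤ (ψ \ T'.image par).card * 2 :=
    (Finset.card_le_card hX).trans (Finset.card_biUnion_le_card_mul _ _ _
      fun C hC => hg.card_le C (Finset.mem_sdiff.1 hC).1)
  have h1 := Finset.card_sdiff_add_card_eq_card hPψ
  have h2 : T.card ≤ T'.card + 2 := by
    have : T.card - ({h, g} : Finset (Lit V)).card ≤ T'.card := Finset.le_card_sdiff _ _
    have h3 : ({h, g} : Finset (Lit V)).card ≤ 2 := Finset.card_le_two
    omega
  omega

theorem four_mul_card_le [Fintype V] (hg : Reg ψ I G) {h : Lit V}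
    (hmax : ∀ w, (users I G w).card ≤ (users I G h).card) (h4 : 4 ≤ (users I G h).card) :
    4 * I.card ≤ (ψ.card + 3) ^ 2 := by
  classical
  obtain ⟨o, ho⟩ := hg.exists_isStar h
  obtain ⟨i₁, hi₁, hb⟩ := Finset.exists_max_image (users I G h) (fun i => (users I G (o i)).card)
    (Finset.card_pos.1 (by omega))
  obtain ⟨hgh, hG₁⟩ := ho i₁ hi₁
  have hi₁I := (Finset.mem_filter.1 hi₁).1
  obtain ⟨o', ho'⟩ := hg.exists_isStar (o i₁)
  have hi₁' : i₁ ∈ users I G (o i₁) := Finset.mem_filter.2 ⟨hi₁I, by rw [hG₁]; simp⟩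
  have ho₁ : o' i₁ = h := by
    obtain ⟨h1, h2⟩ := ho' i₁ hi₁'
    have : o' i₁ ∈ G i₁ := by rw [h2]; simp
    rw [hG₁] at this
    simpa [h1] using this
  set g := o i₁ with hgdef
  obtain ⟨α, hα, hs⟩ := hg.sat i₁ hi₁I
  have hαh : LitSat α h := hs h (by simp [hG₁])
  have hαg : LitSat α g := hs g (by simp [hG₁])
  set T : Finset (Lit V) := Finset.univ.filter fun w => Reach ψ h w ∨ Reach ψ g w with hTdef
  have hT : ∀ w, w ∈ T ↔ Reach ψ h w ∨ Reach ψ g w := fun w => by simp [hTdef]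
  set J := (users I G h).erase i₁ with hJ
  set J' := (users I G g).erase i₁ with hJ'
  have hJc : J.card + 1 = (users I G h).card := Finset.card_erase_add_one hi₁
  have hJc' : J'.card + 1 = (users I G g).card := Finset.card_erase_add_one hi₁'
  have hb1 : 1 ≤ (users I G g).card := by omega
  have hJu : ∀ i ∈ J, i ∈ users I G h := fun i hi => Finset.mem_of_mem_erase hi
  have hJu' : ∀ i ∈ J', i ∈ users I G g := fun i hi => Finset.mem_of_mem_erase hi
  set M := J.image fun i => negLit (o i) with hM
  set M' := J'.image fun i => negLit (o' i) with hM'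
  have hMc : M.card = J.card := Finset.card_image_of_injOn fun i hi j hj he =>
    hg.star_injOn ho (hJu i hi) (hJu j hj) (negLit_inj.1 he)
  have hMc' : M'.card = J'.card := Finset.card_image_of_injOn fun i hi j hj he =>
    hg.star_injOn ho' (hJu' i hi) (hJu' j hj) (negLit_inj.1 he)
  have hMT : M ⊆ T := Finset.image_subset_iff.2 fun i hi => (hT _).2 <| Or.inr <|
    hg.star_reach ho hi₁ (hJu i hi) (Finset.ne_of_mem_erase hi).symm
  have hMT' : M' ⊆ T := Finset.image_subset_iff.2 fun i hi => (hT _).2 <| Or.inl <| by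
    have := hg.star_reach ho' hi₁' (hJu' i hi) (Finset.ne_of_mem_erase hi).symm
    rwa [ho₁] at this
  have hdisj : Disjoint M M' := by
    rw [Finset.disjoint_left]
    intro w hw hw'
    obtain ⟨i, hi, rfl⟩ := Finset.mem_image.1 hw
    obtain ⟨j, hj, he⟩ := Finset.mem_image.1 hw'
    have hiU := ho i (hJu i hi)
    have hjU := ho' j (hJu' j hj)
    rw [negLit_inj.1 he] at hjU
    have hij : i ≠ j := by
      rintro rfl
      have : g ∈ G i := by rw [hjU.2]; simp
      rw [hiU.2] at this
      simp only [Finset.mem_insert, Finset.mem_singleton] at this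
      rcases this with e | e
      · exact hgh e
      · exact hjU.1 e.symm
    have := hg.reach_other (Finset.mem_filter.1 (hJu i hi)).1 (Finset.mem_filter.1 (hJu' j hj)).1
      hij (hiU.2.trans (Finset.pair_comm _ _)) (hjU.2.trans (Finset.pair_comm _ _))
    exact not_litSat_negLit hαg (this.litSat hα hαh)
  have ht : J.card + J'.card ≤ T.card := by
    rw [← hMc, ← hMc', ← Finset.card_union_of_disjoint hdisj]
    exact Finset.card_le_card (Finset.union_subset hMT hMT')
  have hn : I.card ≤ 1 + ((T \ M).card * (users I G h).card + M.card * (users I G g).card) := by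
    have h1 : I.erase i₁ ⊆ ((T \ M).biUnion fun w => users I G (negLit w)) ∪
        M.biUnion fun w => users I G (negLit w) := by
      intro j hj
      obtain ⟨hj1, hj⟩ := Finset.mem_erase.1 hj
      obtain ⟨u, hu, v, hv, hr⟩ := hg.excl i₁ hi₁I j hj hj1.symm
      have hvT : negLit v ∈ T := by
        rw [hG₁] at hu
        simp only [Finset.mem_insert, Finset.mem_singleton] at hu
        rcases hu with rfl | rfl
        · exact (hT _).2 (Or.inl hr)
        · exact (hT _).2 (Or.inr hr)
      have hjv : j ∈ users I G (negLit (negLit v)) := by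
        rw [negLit_negLit]; exact Finset.mem_filter.2 ⟨hj, hv⟩
      by_cases hvM : negLit v ∈ M
      · exact Finset.mem_union_right _ (Finset.mem_biUnion.2 ⟨_, hvM, hjv⟩)
      · exact Finset.mem_union_left _
          (Finset.mem_biUnion.2 ⟨_, Finset.mem_sdiff.2 ⟨hvT, hvM⟩, hjv⟩)
    have h2 := (Finset.card_le_card h1).trans (Finset.card_union_le _ _)
    have h3 : ((T \ M).biUnion fun w => users I G (negLit w)).card ≤
        (T \ M).card * (users I G h).card :=
      Finset.card_biUnion_le_card_mul _ _ _ fun w _ => hmax _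
    have h4 : (M.biUnion fun w => users I G (negLit w)).card ≤ M.card * (users I G g).card := by
      refine Finset.card_biUnion_le_card_mul _ _ _ fun w hw => ?_
      obtain ⟨i, hi, rfl⟩ := Finset.mem_image.1 hw
      rw [negLit_negLit]
      exact hb i (hJu i hi)
    have h5 := Finset.card_erase_add_one hi₁I
    omega
  have htM := Finset.card_sdiff_add_card_eq_card hMT
  obtain ⟨c, hcinj, hc⟩ := hg.exists_branching_fun ho (by omega) hi₁
  set D := J.image fun i => negLit (c i) with hD
  have hDc : D.card = J.card := Finset.card_image_of_injOn fun i hi j hj he =>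
    hcinj hi hj (negLit_inj.1 he)
  have hDT : D ⊆ T := Finset.image_subset_iff.2 fun i hi => (hT _).2 <| Or.inr (hc i hi).2.1
  have hDp : ∀ d ∈ D, d ≠ h ∧ d ≠ g ∧ 2 ≤ (ψ.filter (d ∈ ·)).card := by
    intro d hd
    obtain ⟨i, hi, rfl⟩ := Finset.mem_image.1 hd
    exact (hc i hi).2.2
  have hE := hg.card_add_two_mul_card_le hα hαh hαg hT hDT hDp
  have hE' : 3 ≤ (users I G g).card → J.card + J'.card + 2 * T.card ≤ 2 * ψ.card + 4 := by
    intro h3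
    obtain ⟨c', hcinj', hc'⟩ := hg.exists_branching_fun ho' h3 hi₁'
    rw [ho₁] at hc'
    set D' := J'.image fun i => negLit (c' i) with hD'
    have hDc' : D'.card = J'.card := Finset.card_image_of_injOn fun i hi j hj he =>
      hcinj' hi hj (negLit_inj.1 he)
    have hdis : Disjoint D D' := by
      rw [Finset.disjoint_left]
      intro w hw hw'
      obtain ⟨i, hi, rfl⟩ := Finset.mem_image.1 hw
      obtain ⟨j, hj, he⟩ := Finset.mem_image.1 hw'
      have hj' := hc' j hj
      rw [negLit_inj.1 he] at hj'
      have hjG := (ho' j (hJu' j hj)).2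
      exact hg.not_reach_neg (Finset.mem_filter.1 (hJu' j hj)).1 (u := o' j) (v := g)
        (by simp [hjG]) (by simp [hjG]) hj'.1 (hc i hi).2.1
    have := hg.card_add_two_mul_card_le hα hαh hαg hT (D := D ∪ D')
      (Finset.union_subset hDT <| Finset.image_subset_iff.2 fun i hi =>
        (hT _).2 <| Or.inl (hc' i hi).2.1) fun d hd => by
        rcases Finset.mem_union.1 hd with hd | hd
        · exact hDp d hd
        · obtain ⟨i, hi, rfl⟩ := Finset.mem_image.1 hd
          obtain ⟨h1, h2, h3, h4, h5⟩ := hc' i hi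
          exact ⟨h4, h3, h5⟩
    rwa [Finset.card_union_of_disjoint hdis, hDc, hDc'] at this
  have hbk := hmax g
  have := pigeonhole_bound (n := I.card) (k := (users I G h).card) (b := (users I G g).card)
    (t := T.card) (E := ψ.card) (by exact_mod_cast h4) (by exact_mod_cast hb1)
    (by exact_mod_cast hbk) ?_ (by omega) (by omega) (by omega)
  · exact_mod_cast this
  · have e1 : ((T.card : ℤ) - ((users I G h).card - 1)) = (T \ M).card := by omega
    have e2 : (((users I G h).card : ℤ) - 1) = M.card := by omega
    rw [e1, e2]
    have : (I.card : ℤ) ≤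
        1 + ((T \ M).card * (users I G h).card + M.card * (users I G g).card) := by
      exact_mod_cast hn
    linarith [mul_comm ((T \ M).card : ℤ) (users I G h).card,
      mul_comm (M.card : ℤ) (users I G g).card]

end Reg

/-- The lower bound, extended to small numbers of inputs. -/
noncomputable def lowerBound (n : ℕ) : ℝ := min (3 * n - 6) (2 * n + 2 * √n - 3)

lemma lowerBound_le_add {n m d : ℕ} (h : n ≤ m + d) :
    lowerBound n ≤ lowerBound m + 3 * d := by
  have h' : (n : ℝ) ≤ m + d := by exact_mod_cast h
  have hd : (0 : ℝ) ≤ d := Nat.cast_nonneg d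
  rw [lowerBound, lowerBound, ← min_add_add_right]
  rcases Nat.eq_zero_or_pos m with rfl | hm
  · refine (min_le_left _ _).trans (le_min ?_ ?_) <;> push_cast at * <;> norm_num <;> linarith
  · refine min_le_min (by linarith) ?_
    have hm' : (1 : ℝ) ≤ m := by exact_mod_cast hm
    have hs : √(m : ℝ) ^ 2 = m := Real.sq_sqrt (by linarith)
    have hs1 : 1 ≤ √(m : ℝ) := Real.one_le_sqrt.2 hm'
    have : √(n : ℝ) ≤ √m + d / 2 := Real.sqrt_le_iff.2 ⟨by positivity, by nlinarith⟩
    linarith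

lemma Irred.false_of_card_eq_three [DecidableEq ι] {φ : CNF V} {I : Finset ι} {p : ι → Lit V}
    (hr : Irred φ I) (h : Enc φ I p) (h3 : I.card = 3) (hφ : φ.card ≤ 2) : False := by
  have hQ : ∀ i ∈ I, inputClauses φ p i = φ := fun i hi =>
    Finset.eq_of_subset_of_card_le (Finset.filter_subset _ _)
      (by rw [hr.card_inputClauses h h3.ge hi]; exact hφ)
  obtain ⟨i, hi⟩ : I.Nonempty := Finset.card_pos.1 (by omega)
  obtain ⟨C, hC⟩ : φ.Nonempty := by
    rw [← hQ i hi, ← Finset.card_pos, hr.card_inputClauses h h3.ge hi]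
    norm_num
  have hsub : I.image (fun i => negLit (p i)) ⊆ C := Finset.image_subset_iff.2 fun j hj => by
    rw [← hQ j hj] at hC
    exact (Finset.mem_filter.1 hC).2
  have hc := Finset.card_le_card hsub
  rw [Finset.card_image_of_injOn] at hc
  · have := h.card_le C hC
    omega
  · intro i hi j hj he
    by_contra hij
    exact h.not_reach hi hj hij (negLit_inj.1 he ▸ Reach.refl _)

lemma Irred.lowerBound_le [DecidableEq ι] [Fintype V] {φ : CNF V} {I : Finset ι} {p : ι → Lit V}
    (hr : Irred φ I) (h : Enc φ I p) (h4 : 4 ≤ I.card) : lowerBound I.card ≤ φ.card := by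
  have hcore : ((core φ I p).card : ℝ) + 2 * I.card ≤ φ.card := by
    exact_mod_cast hr.card_core_add h h4
  refine (min_le_right _ _).trans ?_
  have hs : √(I.card : ℝ) ^ 2 = I.card := Real.sq_sqrt (Nat.cast_nonneg _)
  by_cases hdeg : ∀ y, (users I (nbr φ p) y).card ≤ 3
  · have : (I.card : ℝ) ≤ 3 * (core φ I p).card := by
      exact_mod_cast hr.card_le_three_mul_core h h4 hdeg
    nlinarith [sq_nonneg (√(I.card : ℝ) - 3)]
  · push Not at hdeg
    obtain ⟨y, hy⟩ := hdeg
    obtain ⟨w, -, hw⟩ := Finset.exists_max_image Finset.univ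
      (fun y => (users I (nbr φ p) y).card) ⟨y, Finset.mem_univ y⟩
    have h1 : (4 * I.card : ℝ) ≤ ((core φ I p).card + 3) ^ 2 := by
      exact_mod_cast (hr.reg h h4).four_mul_card_le (fun v => hw v (Finset.mem_univ v))
        (lt_of_lt_of_le hy (hw y (Finset.mem_univ y)))
    have h2 : 2 * √(I.card : ℝ) ≤ (core φ I p).card + 3 :=
      le_of_sq_le_sq (by rw [mul_pow, hs]; linarith) (by positivity)
    linarith

theorem Enc.lowerBound_le [DecidableEq ι] [Fintype V] {φ : CNF V} {I : Finset ι} {p : ι → Lit V}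
    (h : Enc φ I p) : lowerBound I.card ≤ φ.card := by
  induction hN : φ.card using Nat.strong_induction_on generalizing φ I p with
  | _ N ih =>
    subst hN
    by_contra hlt
    have hr : Irred φ I := by
      intro φ' I' p' d h' hlt' hI hd
      have h1 := ih _ hlt' h' rfl
      have h2 := lowerBound_le_add hI
      have h3 : (φ'.card : ℝ) + 3 * d ≤ φ.card := by exact_mod_cast hd
      linarith
    rcases le_or_gt 4 I.card with h4 | h4
    · exact hlt (hr.lowerBound_le h h4)
    have hle : lowerBound I.card ≤ 3 * I.card - 6 := min_le_left _ _
    have hlt2 : (φ.card : ℝ) + 6 < 3 * I.card := by linarith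
    have hlt3 : φ.card + 6 < 3 * I.card := by exact_mod_cast hlt2
    exact hr.false_of_card_eq_three h (by omega) (by omega)

/-- Unit propagation in a 2-CNF formula follows paths of the implication graph. -/
lemma unitDerives_addUnit {φ : CNF V} (hφ : Is2CNF φ) {a : Lit V} {C : Clause V}
    (h : UnitDerives (addUnit φ a) C) :
    C ∈ φ ∨ (∃ l, C = {l} ∧ Reach φ a l) ∨
      (∃ l, C = {l} ∧ ∀ α, CnfSat α φ → LitSat α l) ∨ C = ∅ := by
  induction h with
  | base h =>
    rcases Finset.mem_insert.1 h with rfl | h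
    · exact Or.inr (Or.inl ⟨a, rfl, Reach.refl a⟩)
    · exact Or.inl h
  | @step l C _ _ hlC ih₁ ih₂ =>
    rcases ih₂ with hC | ⟨m, rfl, -⟩ | ⟨m, rfl, -⟩ | rfl
    · obtain ⟨b, rfl⟩ := clause_eq_pair (hφ C hC) hlC
      by_cases hb : b = negLit l
      · subst hb
        exact Or.inr (Or.inr (Or.inr (by simp)))
      have he : ({negLit l, b} : Clause V).erase (negLit l) = {b} :=
        Finset.erase_insert (by simpa using Ne.symm hb)
      have harc : Arc φ l b := hC
      rw [he]
      rcases ih₁ with hl | ⟨m, hm, hr⟩ | ⟨m, hm, hr⟩ | hl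
      · refine Or.inr (Or.inr (Or.inl ⟨b, rfl, fun α hα => harc.reach.litSat hα ?_⟩))
        obtain ⟨l', hl', hs⟩ := hα _ hl
        rwa [Finset.mem_singleton.1 hl'] at hs
      · obtain rfl := Finset.singleton_injective hm
        exact Or.inr (Or.inl ⟨b, rfl, hr.trans harc.reach⟩)
      · obtain rfl := Finset.singleton_injective hm
        exact Or.inr (Or.inr (Or.inl ⟨b, rfl, fun α hα => harc.reach.litSat hα (hr α hα)⟩))
      · exact absurd hl (Finset.singleton_ne_empty _)
    · rw [Finset.mem_singleton.1 hlC]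
      exact Or.inr (Or.inr (Or.inr (by simp)))
    · rw [Finset.mem_singleton.1 hlC]
      exact Or.inr (Or.inr (Or.inr (by simp)))
    · simp at hlC

lemma negLit_inLit {n ℓ : ℕ} (i : Fin n) (b : Bool) :
    negLit (inLit i b : Lit (Var n ℓ)) = inLit i !b := rfl

lemma IsPEncoding.enc {n ℓ : ℕ} {φ : CNF (Var n ℓ)} (h : IsPEncoding φ) (h2 : Is2CNF φ) :
    Enc φ Finset.univ fun i : Fin n => (inLit i true : Lit (Var n ℓ)) := by
  obtain ⟨-, hsat, hder⟩ := h
  refine ⟨h2, fun i _ => hsat i, fun i _ j _ hij => ?_⟩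
  obtain ⟨α, hα, hj⟩ := hsat j
  have himp : ¬ LitSat α (inLit j false : Lit (Var n ℓ)) :=
    not_litSat_negLit (a := inLit j true) hj
  rcases unitDerives_addUnit h2 (hder i j hij) with hl | ⟨m, hm, hr⟩ | ⟨m, hm, hr⟩ | hl
  · obtain ⟨l', hl', hs⟩ := hα _ hl
    rw [Finset.mem_singleton.1 hl'] at hs
    exact absurd hs himp
  · obtain rfl := Finset.singleton_injective hm
    exact hr
  · obtain rfl := Finset.singleton_injective hm
    exact absurd (hr α hα) himp
  · exact absurd hl (Finset.singleton_ne_empty _)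

lemma inLit_inj {n ℓ : ℕ} {i j : Fin n} {b c : Bool} :
    (inLit i b : Lit (Var n ℓ)) = inLit j c ↔ i = j ∧ b = c := by
  simp [inLit]

/-- The pairwise exclusion clauses form an encoding without auxiliary variables. -/
lemma penc2Sizes_nonempty (n : ℕ) : (penc2Sizes n).Nonempty := by
  let φ : CNF (Var n 0) := (Finset.univ : Finset (Fin n)).offDiag.image
    fun q => {inLit q.1 false, inLit q.2 false}
  have hmem : ∀ i j : Fin n, i ≠ j → ({inLit i false, inLit j false} : Clause (Var n 0)) ∈ φ :=
    fun i j hij => Finset.mem_image.2 ⟨(i, j), by simpa using hij, rfl⟩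
  refine ⟨φ.card, 0, φ, ⟨fun C hC => ?_, fun i => ?_, fun i j hij => ?_⟩, fun C hC => ?_, rfl⟩
  · obtain ⟨q, -, rfl⟩ := Finset.mem_image.1 hC
    intro l hl
    simp only [Finset.mem_insert, Finset.mem_singleton] at hl ⊢
    rcases hl with rfl | rfl <;> simp [negLit_inLit, inLit_inj]
  · refine ⟨fun v => decide (v = Sum.inl i), fun C hC => ?_, by simp⟩
    obtain ⟨q, hq, rfl⟩ := Finset.mem_image.1 hC
    have hq : q.1 ≠ q.2 := by simpa using hq
    by_cases h1 : q.1 = i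
    · refine ⟨inLit q.2 false, by simp, ?_⟩
      have : q.2 ≠ i := fun e => hq (h1.trans e.symm)
      simpa [LitSat, inLit] using this
    · refine ⟨inLit q.1 false, by simp, ?_⟩
      simpa [LitSat, inLit] using h1
  · have h1 : UnitDerives (addUnit φ (inLit i true)) {inLit i true} :=
      UnitDerives.base (Finset.mem_insert_self _ _)
    have h2 : UnitDerives (addUnit φ (inLit i true)) {inLit i false, inLit j false} :=
      UnitDerives.base (Finset.mem_insert_of_mem (hmem i j hij))
    have h3 := UnitDerives.step h1 h2 (by simp [negLit_inLit])
    rwa [negLit_inLit, Bool.not_true, Finset.erase_insert (by simp [inLit_inj, hij])] at h3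
  · obtain ⟨q, -, rfl⟩ := Finset.mem_image.1 hC
    exact Finset.card_le_two

end TwoCNF

/-- For every n ≥ 9, the minimum size S₂(n) of a 2-CNF p-encoding with
n input variables satisfies S₂(n) ≥ 2n + 2√n − 3. -/
theorem penc2_lower_bound (n : ℕ) (hn : 9 ≤ n) :
    (2 * (n : ℝ) + 2 * Real.sqrt n - 3) ≤ (S2 n : ℝ) := by
  obtain ⟨ℓ, φ, hφ, h2, hc⟩ := Nat.sInf_mem (TwoCNF.penc2Sizes_nonempty n)
  have h := (TwoCNF.IsPEncoding.enc hφ h2).lowerBound_le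
  rw [Finset.card_univ, Fintype.card_fin, hc] at h
  refine le_trans (le_min ?_ le_rfl) h
  have hn' : (9 : ℝ) ≤ n := by exact_mod_cast hn
  have hs : √(n : ℝ) ^ 2 = n := Real.sq_sqrt (by linarith)
  have hs3 : 3 ≤ √(n : ℝ) := Real.le_sqrt_of_sq_le (by linarith)
  nlinarith
end
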